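/- arXiv:2407.16679 — 12 statements merged into one kernel-verified Lean document; each statement's English description precedes it below -/
import Mathlib

section
/- Let f : X → Y and f' : X' → Y' be proper maps between ANR spaces, and let λ : X → X' and μ : Y → Y' be proper homotopy equivalences such that μ ∘ f is properly homotopic to f' ∘ λ. Then p-secat(f) = p-secat(f'). In particular, the proper sectional category is an invariant of the proper homotopy type of a proper map. -/
open Set unitInterval
open scoped NNReal ENNReal

noncomputable section

universe u v

/-- A proper homotopy between two maps: a continuous map `H : X × [0,1] → Y` which is itself
proper, restricting to `f` at time `0` and to `g` at time `1`. -/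
def ProperlyHomotopic {X : Type*} {Y : Type*} [TopologicalSpace X] [TopologicalSpace Y]
    (f g : X → Y) : Prop :=
  ∃ H : X × unitInterval → Y, IsProperMap H ∧
    (∀ x, H (x, 0) = f x) ∧ (∀ x, H (x, 1) = g x)

/-- An ordinary (unbundled) homotopy between two maps. -/
def Homotopic' {X : Type*} {Y : Type*} [TopologicalSpace X] [TopologicalSpace Y]
    (f g : X → Y) : Prop :=
  ∃ H : X × unitInterval → Y, Continuous H ∧
    (∀ x, H (x, 0) = f x) ∧ (∀ x, H (x, 1) = g x)

/-- A proper homotopy equivalence: a proper map admitting a proper homotopy inverse. -/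
def IsProperHomotopyEquiv {X : Type*} {Y : Type*} [TopologicalSpace X] [TopologicalSpace Y]
    (f : X → Y) : Prop :=
  IsProperMap f ∧ ∃ g : Y → X, IsProperMap g ∧
    ProperlyHomotopic (g ∘ f) (id : X → X) ∧ ProperlyHomotopic (f ∘ g) (id : Y → Y)

/-- `PSecatLE f n`: the proper sectional category of the proper map `f` is at most `n`, i.e.
`Y` admits an open cover by `n + 1` sets, each of whose closures carries a proper map to `X`
whose composition with `f` is properly homotopic to the inclusion. -/
def PSecatLE {X : Type*} {Y : Type*} [TopologicalSpace X] [TopologicalSpace Y]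
    (f : X → Y) (n : ℕ) : Prop :=
  ∃ U : Fin (n + 1) → Set Y, (∀ i, IsOpen (U i)) ∧ (⋃ i, U i) = Set.univ ∧
    ∀ i, ∃ s : closure (U i) → X, IsProperMap s ∧
      ProperlyHomotopic (fun y => f (s y)) (fun y : closure (U i) => (y : Y))

/-- The proper sectional category of a proper map, with value in `ℕ∞`. -/
def pSecat {X : Type*} {Y : Type*} [TopologicalSpace X] [TopologicalSpace Y]
    (f : X → Y) : ℕ∞ :=
  sInf {n : ℕ∞ | ∃ m : ℕ, n = (m : ℕ∞) ∧ PSecatLE f m}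

/-- `SecatLE f n`: the (classical) sectional category of `f` is at most `n`. -/
def SecatLE {X : Type*} {Y : Type*} [TopologicalSpace X] [TopologicalSpace Y]
    (f : X → Y) (n : ℕ) : Prop :=
  ∃ U : Fin (n + 1) → Set Y, (∀ i, IsOpen (U i)) ∧ (⋃ i, U i) = Set.univ ∧
    ∀ i, ∃ s : U i → X, Continuous s ∧
      Homotopic' (fun y => f (s y)) (fun y : U i => (y : Y))

/-- The classical sectional category of a continuous map, with value in `ℕ∞`. -/
def secat {X : Type*} {Y : Type*} [TopologicalSpace X] [TopologicalSpace Y]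
    (f : X → Y) : ℕ∞ :=
  sInf {n : ℕ∞ | ∃ m : ℕ, n = (m : ℕ∞) ∧ SecatLE f m}

/-- `PCatLE α n`: the `α`-proper Lusternik–Schnirelmann category of `X` is at most `n`.
Here `ℝ≥0 = [0,∞)` and `α : [0,∞) → X` is a ray. -/
def PCatLE {X : Type*} [TopologicalSpace X] (α : ℝ≥0 → X) (n : ℕ) : Prop :=
  ∃ U : Fin (n + 1) → Set X, (∀ i, IsOpen (U i)) ∧ (⋃ i, U i) = Set.univ ∧
    ∀ i, ∃ r : closure (U i) → ℝ≥0, IsProperMap r ∧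
      ProperlyHomotopic (fun x : closure (U i) => (x : X)) (fun x => α (r x))

/-- The `α`-proper Lusternik–Schnirelmann category, with value in `ℕ∞`. -/
def pCat {X : Type*} [TopologicalSpace X] (α : ℝ≥0 → X) : ℕ∞ :=
  sInf {n : ℕ∞ | ∃ m : ℕ, n = (m : ℕ∞) ∧ PCatLE α m}

/-- `LSCatLE X n`: the Lusternik–Schnirelmann category of `X` is at most `n`, i.e. `X` admits
an open cover by `n + 1` sets whose inclusions are nullhomotopic. -/
def LSCatLE (X : Type*) [TopologicalSpace X] (n : ℕ) : Prop :=
  ∃ U : Fin (n + 1) → Set X, (∀ i, IsOpen (U i)) ∧ (⋃ i, U i) = Set.univ ∧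
    ∀ i, ∃ x₀ : X, Homotopic' (fun x : U i => (x : X)) (fun _ => x₀)

/-- The Lusternik–Schnirelmann category, with value in `ℕ∞`. -/
def lsCat (X : Type*) [TopologicalSpace X] : ℕ∞ :=
  sInf {n : ℕ∞ | ∃ m : ℕ, n = (m : ℕ∞) ∧ LSCatLE X m}

/-- `TCLE X n`: the topological complexity of `X` is at most `n`: there is an open cover
`U_0, …, U_n` of `X × X` with continuous local sections of the path fibration. -/
def TCLE (X : Type*) [TopologicalSpace X] (n : ℕ) : Prop :=
  ∃ U : Fin (n + 1) → Set (X × X), (∀ i, IsOpen (U i)) ∧ (⋃ i, U i) = Set.univ ∧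
    ∀ i, ∃ s : U i → C(unitInterval, X), Continuous s ∧
      ∀ p : U i, s p 0 = (p : X × X).1 ∧ s p 1 = (p : X × X).2

/-- The topological complexity of `X`, with value in `ℕ∞`. -/
def TC' (X : Type*) [TopologicalSpace X] : ℕ∞ :=
  sInf {n : ℕ∞ | ∃ m : ℕ, n = (m : ℕ∞) ∧ TCLE X m}

/-- `PTCLE X n`: the proper topological complexity of `X` is at most `n`: there is an open
cover `U_0, …, U_n` of `X × X` with continuous local sections `s_i` of the path fibration such
that every compact `K ⊆ X` is contained in a compact `L` with `s_i (x, y) t ∉ K` whenever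
`(x, y) ∈ U_i`, `x ∉ L` and `y ∉ L`. -/
def PTCLE (X : Type*) [TopologicalSpace X] (n : ℕ) : Prop :=
  ∃ U : Fin (n + 1) → Set (X × X), (∀ i, IsOpen (U i)) ∧ (⋃ i, U i) = Set.univ ∧
    ∃ s : (i : Fin (n + 1)) → U i → C(unitInterval, X),
      (∀ i, Continuous (s i)) ∧
      (∀ i (p : U i), s i p 0 = (p : X × X).1 ∧ s i p 1 = (p : X × X).2) ∧
      (∀ K : Set X, IsCompact K → ∃ L : Set X, IsCompact L ∧ K ⊆ L ∧
        ∀ i (p : U i), (p : X × X).1 ∉ L → (p : X × X).2 ∉ L →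
          ∀ t : unitInterval, s i p t ∉ K)

/-- The proper topological complexity of `X`, with value in `ℕ∞`. -/
def pTC (X : Type*) [TopologicalSpace X] : ℕ∞ :=
  sInf {n : ℕ∞ | ∃ m : ℕ, n = (m : ℕ∞) ∧ PTCLE X m}

/-- An ANR: a metrizable space which, whenever embedded as a closed subspace of a metrizable
space, is a retract of an open neighborhood. -/
def IsANR (X : Type u) [TopologicalSpace X] : Prop :=
  TopologicalSpace.MetrizableSpace X ∧
  ∀ (Z : Type u) [TopologicalSpace Z], TopologicalSpace.MetrizableSpace Z →
    ∀ e : X → Z, Topology.IsClosedEmbedding e →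
      ∃ U : Set Z, IsOpen U ∧ Set.range e ⊆ U ∧
        ∃ r : U → X, Continuous r ∧ ∀ (x : X) (h : e x ∈ U), r ⟨e x, h⟩ = x

/-- The wedge `X ∨ Y` of two pointed spaces: the quotient of `X ⊕ Y` identifying the two base
points. -/
abbrev Wedge (X Y : Type*) [TopologicalSpace X] [TopologicalSpace Y] (x₀ : X) (y₀ : Y) :=
  Quot (fun a b : X ⊕ Y => a = Sum.inl x₀ ∧ b = Sum.inr y₀)

universe u1 u2 v1 v2

namespace IsProperMap

variable {X Y Z : Type*} [TopologicalSpace X] [TopologicalSpace Y] [TopologicalSpace Z]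

/-- Two proper maps with the same target assemble to a proper map on the disjoint union. -/
theorem sumElim {f : X → Z} {g : Y → Z} (hf : IsProperMap f) (hg : IsProperMap g) :
    IsProperMap (Sum.elim f g) := by
  rw [isProperMap_iff_isClosedMap_and_compact_fibers]
  refine ⟨hf.continuous.sumElim hg.continuous, hf.isClosedMap.sumElim hg.isClosedMap, fun z => ?_⟩
  have hz : Sum.elim f g ⁻¹' {z} = Sum.inl '' (f ⁻¹' {z}) ∪ Sum.inr '' (g ⁻¹' {z}) := by
    ext (x | x) <;> simp
  rw [hz]
  exact ((hf.isCompact_preimage isCompact_singleton).image continuous_inl).union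
    ((hg.isCompact_preimage isCompact_singleton).image continuous_inr)

end IsProperMap

namespace ProperlyHomotopic

variable {X Y Z : Type*} [TopologicalSpace X] [TopologicalSpace Y] [TopologicalSpace Z]

theorem symm {f g : X → Y} (h : ProperlyHomotopic f g) : ProperlyHomotopic g f := by
  obtain ⟨H, hH, h0, h1⟩ := h
  refine ⟨fun p => H (p.1, σ p.2), ?_, fun x => by simp [h1], fun x => by simp [h0]⟩
  exact hH.comp
    ((Homeomorph.refl X).prodCongr unitInterval.symmHomeomorph).isProperMap

theorem comp_left {f g : X → Y} (h : ProperlyHomotopic f g) {k : Y → Z} (hk : IsProperMap k) :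
    ProperlyHomotopic (k ∘ f) (k ∘ g) := by
  obtain ⟨H, hH, h0, h1⟩ := h
  exact ⟨k ∘ H, hk.comp hH, fun x => congrArg k (h0 x), fun x => congrArg k (h1 x)⟩

theorem comp_right {f g : Y → Z} (h : ProperlyHomotopic f g) {k : X → Y} (hk : IsProperMap k) :
    ProperlyHomotopic (f ∘ k) (g ∘ k) := by
  obtain ⟨H, hH, h0, h1⟩ := h
  exact ⟨H ∘ Prod.map k id, hH.comp (hk.prodMap isProperMap_id), fun x => h0 (k x),
    fun x => h1 (k x)⟩

theorem trans {f g k : X → Y} (h : ProperlyHomotopic f g) (h' : ProperlyHomotopic g k) :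
    ProperlyHomotopic f k := by
  obtain ⟨H, hH, h0, h1⟩ := h
  obtain ⟨H', hH', h0', h1'⟩ := h'
  let K : X × I → Y := fun p =>
    if (p.2 : ℝ) ≤ 1 / 2 then H (p.1, projIcc 0 1 zero_le_one (2 * p.2 : ℝ))
    else H' (p.1, projIcc 0 1 zero_le_one (2 * p.2 - 1 : ℝ))
  have hK : Continuous K := by
    refine Continuous.if_le (hH.continuous.comp (by fun_prop)) (hH'.continuous.comp (by fun_prop))
      (by fun_prop) continuous_const fun p hp => ?_
    simp [hp, h1, h0']
  let halves : (X × I) ⊕ (X × I) → X × I :=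
    Sum.elim (fun p => (p.1, ⟨p.2 / 2, by linarith [p.2.2.1], by linarith [p.2.2.2]⟩))
      fun p => (p.1, ⟨(p.2 + 1) / 2, by linarith [p.2.2.1], by linarith [p.2.2.2]⟩)
  have hhalves : Continuous halves := by fun_prop
  have hsurj : Function.Surjective halves := by
    rintro ⟨x, t, ht0, ht1⟩
    rcases le_total t (1 / 2) with ht | ht
    · exact ⟨Sum.inl (x, ⟨2 * t, by linarith, by linarith⟩), by simp [halves]⟩
    · exact ⟨Sum.inr (x, ⟨2 * t - 1, by linarith, by linarith⟩), by simp [halves]⟩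
  have hcomp : K ∘ halves = Sum.elim H H' := by
    ext (⟨x, t⟩ | ⟨x, t⟩)
    · have ht : (t : ℝ) / 2 ≤ 1 / 2 := by linarith [t.2.2]
      exact (if_pos ht).trans (by simp [halves, mul_div_cancel₀])
    · rcases eq_or_ne t 0 with rfl | ht
      · simp [K, halves, h1, h0']
      · have ht' : ¬ ((t : ℝ) + 1) / 2 ≤ 1 / 2 := by
          have : (0 : ℝ) < t := unitInterval.coe_pos.2 (unitInterval.pos_iff_ne_zero.2 ht)
          linarith
        exact (if_neg ht').trans (by simp [halves, mul_div_cancel₀])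
  exact ⟨K, isProperMap_of_comp_of_surj hhalves hK (hcomp ▸ hH.sumElim hH') hsurj,
    fun x => by simp [K, h0], fun x => by norm_num [K, h1']⟩

end ProperlyHomotopic

/-- If `f` is carried to `f'` up to proper homotopy by proper maps `l`, `μ`, and `μ` has a right
inverse up to proper homotopy, then the sectional covers of `f` pull back to those of `f'`. -/
theorem PSecatLE.of_properlyHomotopic {X X' Y Y' : Type*}
    [TopologicalSpace X] [TopologicalSpace X'] [TopologicalSpace Y] [TopologicalSpace Y']
    {f : X → Y} {f' : X' → Y'} {l : X → X'} {μ : Y → Y'} {ν : Y' → Y} {n : ℕ}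
    (h : PSecatLE f n) (hl : IsProperMap l) (hμ : IsProperMap μ) (hν : IsProperMap ν)
    (hμν : ProperlyHomotopic (μ ∘ ν) id) (hcomm : ProperlyHomotopic (μ ∘ f) (f' ∘ l)) :
    PSecatLE f' n := by
  obtain ⟨U, hU, hcover, hs⟩ := h
  refine ⟨fun i => ν ⁻¹' U i, fun i => (hU i).preimage hν.continuous, ?_, fun i => ?_⟩
  · rw [← preimage_iUnion, hcover, preimage_univ]
  obtain ⟨s, hs, hfs⟩ := hs i
  have hmaps : MapsTo ν (closure (ν ⁻¹' U i)) (closure (U i)) :=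
    (mapsTo_preimage ν (U i)).closure hν.continuous
  have hincl : IsProperMap (Subtype.val : closure (ν ⁻¹' U i) → Y') :=
    isClosed_closure.isClosedEmbedding_subtypeVal.isProperMap
  have hr : IsProperMap (hmaps.restrict ν _ _) :=
    isProperMap_of_comp_of_inj (hν.continuous.restrict hmaps) continuous_subtype_val
      (hν.comp hincl) Subtype.val_injective
  have hsr : IsProperMap (s ∘ hmaps.restrict ν _ _) := hs.comp hr
  refine ⟨l ∘ s ∘ hmaps.restrict ν _ _, hl.comp hsr, ?_⟩
  exact ((hcomm.comp_right hsr).symm.trans ((hfs.comp_right hr).comp_left hμ)).trans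
    (hμν.comp_right hincl)

/-- The proper sectional category is an invariant of the proper homotopy type of a proper map:
if `μ ∘ f` is properly homotopic to `f' ∘ l` for proper homotopy equivalences `l`, `μ`, then
`p-secat f = p-secat f'`. -/
theorem pSecat_eq_of_properHomotopyEquiv
    {X : Type u1} {X' : Type u2} {Y : Type v1} {Y' : Type v2}
    [TopologicalSpace X] [TopologicalSpace X'] [TopologicalSpace Y] [TopologicalSpace Y']
    (hX : IsANR X) (hX' : IsANR X') (hY : IsANR Y) (hY' : IsANR Y')
    (f : X → Y) (f' : X' → Y') (hf : IsProperMap f) (hf' : IsProperMap f')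
    (l : X → X') (μ : Y → Y')
    (hl : IsProperHomotopyEquiv l) (hμ : IsProperHomotopyEquiv μ)
    (hcomm : ProperlyHomotopic (μ ∘ f) (f' ∘ l)) :
    pSecat f = pSecat f' := by
  obtain ⟨hl, k, hk, -, hlk⟩ := hl
  obtain ⟨hμ, ν, hν, hνμ, hμν⟩ := hμ
  have hcomm' : ProperlyHomotopic (ν ∘ f') (f ∘ k) :=
    ((hνμ.comp_right (hf.comp hk)).symm.trans
      ((hcomm.comp_right hk).comp_left hν)).trans (hlk.comp_left (hν.comp hf')) |>.symm
  have hiff : ∀ n, PSecatLE f n ↔ PSecatLE f' n := fun n =>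
    ⟨fun h => h.of_properlyHomotopic hl hμ hν hμν hcomm,
      fun h => h.of_properlyHomotopic hk hν hμ hνμ hcomm'⟩
  simp only [pSecat, hiff]

end
end

section
/- For any proper map f : X → Y between ANR spaces, secat(f) ≤ p-secat(f); moreover, if Y is compact then secat(f) = p-secat(f). -/
open Set unitInterval
open scoped NNReal ENNReal

noncomputable section

universe u v

lemma SecatLE.of_pSecatLE {X : Type*} {Y : Type*} [TopologicalSpace X] [TopologicalSpace Y]
    {f : X → Y} {n : ℕ} (h : PSecatLE f n) : SecatLE f n := by
  obtain ⟨U, hU, hcover, hs⟩ := h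
  refine ⟨U, hU, hcover, fun i => ?_⟩
  obtain ⟨s, hs, H, hH, hH0, hH1⟩ := hs i
  have hι : Continuous (inclusion (subset_closure (s := U i))) := continuous_inclusion _
  exact ⟨s ∘ inclusion subset_closure, hs.continuous.comp hι,
    H ∘ Prod.map (inclusion subset_closure) id, hH.continuous.comp (hι.prodMap continuous_id),
    fun _ => hH0 _, fun _ => hH1 _⟩

/-- Over a compact Hausdorff base, a finite open cover can be shrunk so that the closures of the
new sets lie in the old ones; restrictions to these compact closures are automatically proper. -/
lemma PSecatLE.of_secatLE {X : Type*} {Y : Type*} [TopologicalSpace X] [TopologicalSpace Y]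
    [T2Space X] [T2Space Y] [CompactSpace Y] {f : X → Y} {n : ℕ} (h : SecatLE f n) :
    PSecatLE f n := by
  obtain ⟨U, hU, hcover, hs⟩ := h
  obtain ⟨V, hVcover, hV, hVU⟩ :=
    exists_iUnion_eq_closure_subset hU (fun _ => Set.toFinite _) hcover
  refine ⟨V, hV, hVcover, fun i => ?_⟩
  obtain ⟨s, hs, H, hH, hH0, hH1⟩ := hs i
  have hι : Continuous (inclusion (hVU i)) := continuous_inclusion _
  have : CompactSpace (closure (V i)) := isCompact_iff_compactSpace.mp isClosed_closure.isCompact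
  exact ⟨s ∘ inclusion (hVU i), (hs.comp hι).isProperMap,
    H ∘ Prod.map (inclusion (hVU i)) id, (hH.comp (hι.prodMap continuous_id)).isProperMap,
    fun _ => hH0 _, fun _ => hH1 _⟩

lemma pSecat_le_secat {X : Type*} {Y : Type*} [TopologicalSpace X] [TopologicalSpace Y]
    [T2Space X] [T2Space Y] [CompactSpace Y] (f : X → Y) : pSecat f ≤ secat f :=
  sInf_le_sInf fun _ ⟨m, hm, h⟩ => ⟨m, hm, .of_secatLE h⟩

/-- For any proper map `f : X → Y` between ANR spaces, `secat f ≤ p-secat f`, with equality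
when `Y` is compact. -/
theorem secat_le_pSecat {X : Type u} {Y : Type v} [TopologicalSpace X] [TopologicalSpace Y]
    (hX : IsANR X) (hY : IsANR Y) (f : X → Y) (hf : IsProperMap f) :
    secat f ≤ pSecat f ∧ (CompactSpace Y → secat f = pSecat f) := by
  have := hX.1
  have := hY.1
  have hle : secat f ≤ pSecat f :=
    sInf_le_sInf fun _ ⟨m, hm, h⟩ => ⟨m, hm, .of_pSecatLE h⟩
  exact ⟨hle, fun _ => hle.antisymm (pSecat_le_secat f)⟩

end
end

section
/- Let f : X → Y be a proper map between ANR spaces, each of which is Hausdorff, non-compact, σ-compact and locally compact, and let α : [0,∞) → X be a ray of X. Then p-secat(f) ≤ p-cat_{f∘α}(Y). -/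
open Set unitInterval
open scoped NNReal ENNReal

noncomputable section

universe u v

theorem ProperlyHomotopic.symm_s2 {X : Type*} {Y : Type*} [TopologicalSpace X]
    [TopologicalSpace Y] {f g : X → Y} (h : ProperlyHomotopic f g) : ProperlyHomotopic g f := by
  obtain ⟨H, hH, h0, h1⟩ := h
  refine ⟨fun p => H (p.1, σ p.2),
    hH.comp ((Homeomorph.refl X).prodCongr unitInterval.symmHomeomorph).isProperMap, ?_, ?_⟩
  · intro x
    simp [h1]
  · intro x
    simp [h0]

/-- Composing with `α` turns a deformation onto the ray `f ∘ α` into a local section of `f`. -/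
theorem PCatLE.pSecatLE {X : Type*} {Y : Type*} [TopologicalSpace X] [TopologicalSpace Y]
    {f : X → Y} {α : ℝ≥0 → X} (hα : IsProperMap α) {n : ℕ}
    (h : PCatLE (fun t => f (α t)) n) : PSecatLE f n := by
  obtain ⟨U, hU, hcover, hr⟩ := h
  refine ⟨U, hU, hcover, fun i => ?_⟩
  obtain ⟨r, hr, hH⟩ := hr i
  exact ⟨fun y => α (r y), hα.comp hr, hH.symm_s2⟩

/-- For a proper map `f : X → Y` between Hausdorff, non-compact, σ-compact, locally compact
ANR spaces and a ray `α` of `X`, `p-secat f ≤ p-cat_{f ∘ α} Y`. -/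
theorem pSecat_le_pCat {X : Type u} {Y : Type v} [TopologicalSpace X] [TopologicalSpace Y]
    [T2Space X] [NoncompactSpace X] [SigmaCompactSpace X] [LocallyCompactSpace X]
    [T2Space Y] [NoncompactSpace Y] [SigmaCompactSpace Y] [LocallyCompactSpace Y]
    (hX : IsANR X) (hY : IsANR Y)
    (f : X → Y) (hf : IsProperMap f)
    (α : ℝ≥0 → X) (hα : IsProperMap α) :
    pSecat f ≤ pCat (fun t => f (α t)) := by
  refine sInf_le_sInf ?_
  rintro _ ⟨m, rfl, hm⟩
  exact ⟨m, rfl, hm.pSecatLE hα⟩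

end
end

section
/- Let X be an ANR space that is Hausdorff, non-compact, σ-compact and locally compact, with a ray α : [0,∞) → X, let Y be a path-connected compact ANR, fix y₀ ∈ Y, and let α' : [0,∞) → X × Y be the ray α'(t) = (α(t), y₀). Then p-cat_{α'}(X × Y) ≤ p-cat_α(X) + cat(Y). -/
open Set unitInterval
open scoped NNReal ENNReal

noncomputable section

universe u v

/-- A map which is proper on each member of a finite open cover of its domain is proper. -/
lemma isProperMap_of_finite_open_cover {A B ι : Type*} [TopologicalSpace A] [TopologicalSpace B]
    [Finite ι] {s : ι → Set A} (hs : ∀ i, IsOpen (s i)) (hcov : ∀ a, ∃ i, a ∈ s i) {f : A → B}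
    (hf : ∀ i, IsProperMap fun a : s i => f a) : IsProperMap f := by
  refine isProperMap_iff_isClosedMap_and_compact_fibers.2 ⟨?_, ?_, ?_⟩
  · refine continuous_of_cover_nhds (s := s) (fun a => ?_) fun i => ?_
    · obtain ⟨i, hi⟩ := hcov a
      exact ⟨i, (hs i).mem_nhds hi⟩
    · exact continuousOn_iff_continuous_domRestrict.2 (hf i).continuous
  · intro C hC
    have h : f '' C = ⋃ i, (fun a : s i => f a) '' (Subtype.val ⁻¹' C) := by
      ext b
      simp only [mem_image, mem_iUnion, mem_preimage]
      constructor
      · rintro ⟨a, ha, rfl⟩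
        obtain ⟨i, hi⟩ := hcov a
        exact ⟨i, ⟨a, hi⟩, ha, rfl⟩
      · rintro ⟨i, a, ha, rfl⟩
        exact ⟨a, ha, rfl⟩
    rw [h]
    exact isClosed_iUnion_of_finite fun i =>
      (hf i).isClosedMap _ (hC.preimage continuous_subtype_val)
  · intro b
    have h : f ⁻¹' {b} = ⋃ i, Subtype.val '' ((fun a : s i => f a) ⁻¹' {b}) := by
      ext a
      simp only [mem_image, mem_iUnion, mem_preimage, mem_singleton_iff]
      constructor
      · intro ha
        obtain ⟨i, hi⟩ := hcov a
        exact ⟨i, ⟨a, hi⟩, ha, rfl⟩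
      · rintro ⟨i, a, ha, rfl⟩
        exact ha
    rw [h]
    exact isCompact_iUnion fun i =>
      ((hf i).isCompact_preimage isCompact_singleton).image continuous_subtype_val

/-- The set `A` can be properly deformed in `Z` into the ray `β`. -/
def ProperlyDeformsTo {Z : Type*} [TopologicalSpace Z] (β : ℝ≥0 → Z) (A : Set Z) : Prop :=
  ∃ r : A → ℝ≥0, IsProperMap r ∧
    ProperlyHomotopic (fun z : A => (z : Z)) (fun z => β (r z))

/-- A set covered by finitely many disjoint open sets, each of which meets it in a set properly
deformable into `β`, is itself properly deformable into `β`. -/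
lemma ProperlyDeformsTo.of_disjoint_open_cover {Z ι : Type*} [TopologicalSpace Z] [Finite ι]
    {β : ℝ≥0 → Z} {A : Set Z} {O : ι → Set Z} (hO : ∀ i, IsOpen (O i))
    (hdisj : ∀ i j z, z ∈ O i → z ∈ O j → i = j) (hcov : ∀ z ∈ A, ∃ i, z ∈ O i)
    (h : ∀ i, ProperlyDeformsTo β (A ∩ O i)) : ProperlyDeformsTo β A := by
  choose r hr H hH H0 H1 using h
  choose q hq using hcov
  let e (i : ι) : {z : A | (z : Z) ∈ O i} ≃ₜ (A ∩ O i : Set Z) :=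
    { toFun := fun z => ⟨z.1.1, z.1.2, z.2⟩
      invFun := fun z => ⟨⟨z.1, z.2.1⟩, z.2.2⟩
      left_inv := fun _ => rfl
      right_inv := fun _ => rfl
      continuous_toFun := by fun_prop
      continuous_invFun := by fun_prop }
  let e' (i : ι) : {z : A × unitInterval | (z.1 : Z) ∈ O i} ≃ₜ
      (A ∩ O i : Set Z) × unitInterval :=
    { toFun := fun z => (⟨z.1.1.1, z.1.1.2, z.2⟩, z.1.2)
      invFun := fun z => ⟨(⟨z.1.1, z.1.2.1⟩, z.2), z.1.2.2⟩
      left_inv := fun _ => rfl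
      right_inv := fun _ => rfl
      continuous_toFun := by fun_prop
      continuous_invFun := by fun_prop }
  refine ⟨fun z => r (q z z.2) ⟨z, z.2, hq z z.2⟩, ?_,
    fun z => H (q z.1 z.1.2) (⟨z.1, z.1.2, hq z.1 z.1.2⟩, z.2), ?_, ?_, ?_⟩
  · refine isProperMap_of_finite_open_cover (s := fun i => {z : A | (z : Z) ∈ O i})
      (fun i => (hO i).preimage continuous_subtype_val) (fun z => ⟨_, hq z z.2⟩) fun i => ?_
    convert (hr i).comp (e i).isProperMap using 1
    funext z
    have key (j) (hj : j = i) (hz : (z : Z) ∈ O j) :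
        r j ⟨z, z.1.2, hz⟩ = r i ⟨z, z.1.2, z.2⟩ := by
      subst hj; rfl
    exact key _ (hdisj _ _ _ (hq _ _) z.2) (hq _ _)
  · refine isProperMap_of_finite_open_cover
      (s := fun i => {z : A × unitInterval | (z.1 : Z) ∈ O i})
      (fun i => (hO i).preimage (by fun_prop)) (fun z => ⟨_, hq z.1 z.1.2⟩) fun i => ?_
    convert (hH i).comp (e' i).isProperMap using 1
    funext z
    have key (j) (hj : j = i) (hz : (z.1.1 : Z) ∈ O j) :
        H j (⟨z.1.1, z.1.1.2, hz⟩, z.1.2) = H i (⟨z.1.1, z.1.1.2, z.2⟩, z.1.2) := by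
      subst hj; rfl
    exact key _ (hdisj _ _ _ (hq _ _) z.2) (hq _ _)
  · exact fun z => H0 _ _
  · exact fun z => H1 _ _

/-- In a path-connected space, a nullhomotopic map is homotopic to any constant map. -/
lemma Homotopic'.const_of_pathConnected {V Y : Type*} [TopologicalSpace V] [TopologicalSpace Y]
    [PathConnectedSpace Y] {f : V → Y} {y₁ : Y} (h : Homotopic' f fun _ => y₁) (y₀ : Y) :
    Homotopic' f fun _ => y₀ := by
  obtain ⟨G, hG, G0, G1⟩ := h
  have hf : Continuous f := by
    have : f = fun v => G (v, 0) := funext fun v => (G0 v).symm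
    rw [this]
    fun_prop
  let F : ContinuousMap.Homotopy (⟨f, hf⟩ : C(V, Y)) (ContinuousMap.const V y₁) :=
    { toFun := fun p => G (p.2, p.1)
      continuous_toFun := by fun_prop
      map_zero_left := G0
      map_one_left := G1 }
  let γ : Path y₁ y₀ := PathConnectedSpace.somePath y₁ y₀
  let F' : ContinuousMap.Homotopy (ContinuousMap.const V y₁) (ContinuousMap.const V y₀) :=
    { toFun := fun p => γ p.1
      continuous_toFun := by fun_prop
      map_zero_left := fun _ => γ.source
      map_one_left := fun _ => γ.target }
  exact ⟨fun p => F.trans F' (p.2, p.1), by fun_prop, fun v => (F.trans F').map_zero_left v,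
    fun v => (F.trans F').map_one_left v⟩

/-- A closed subset of `X × Y` lying over `C` and over `V` is properly deformable into the ray
`(α, y₀)` when `C` is properly deformable into `α` and `V` is contractible in `Y` to `y₀`. -/
lemma ProperlyDeformsTo.of_subset_prod {X Y : Type*} [TopologicalSpace X] [TopologicalSpace Y]
    [T2Space X] [T2Space Y] [CompactSpace Y] {α : ℝ≥0 → X} {y₀ : Y} {C : Set X} {V : Set Y}
    (hC : ProperlyDeformsTo α C) (hV : Homotopic' (fun y : V => (y : Y)) fun _ => y₀)
    {A : Set (X × Y)} (hA : IsClosed A) (hAC : ∀ z ∈ A, z.1 ∈ C) (hAV : ∀ z ∈ A, z.2 ∈ V) :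
    ProperlyDeformsTo (fun t => (α t, y₀)) A := by
  obtain ⟨r, hr, H, hH, H0, H1⟩ := hC
  obtain ⟨G, hG, G0, G1⟩ := hV
  let toC : A → C := fun z => ⟨z.1.1, hAC _ z.2⟩
  have h_toC : IsProperMap toC := by
    have hj : IsProperMap fun z : A => ((toC z, z.1.2) : C × Y) :=
      isProperMap_of_comp_of_t2 (g := Prod.map Subtype.val id) (by fun_prop) (by fun_prop)
        hA.isProperMap_subtypeVal
    exact isProperMap_fst_of_compactSpace.comp hj
  refine ⟨r ∘ toC, hr.comp h_toC,
    fun p => (H (toC p.1, p.2), G (⟨p.1.1.2, hAV _ p.1.2⟩, p.2)), ?_, ?_, ?_⟩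
  · have hHc := hH.continuous
    have h_toCc := h_toC.continuous
    exact isProperMap_of_comp_of_t2 (g := Prod.fst) (by fun_prop) continuous_fst
      (hH.comp (h_toC.prodMap isProperMap_id))
  · exact fun z => Prod.ext (H0 _) (G0 _)
  · exact fun z => Prod.ext (H1 _) (G1 _)

/-- In a metrizable space, every open set is the positivity set of a continuous function. -/
lemma exists_continuous_pos_iff_mem {X : Type*} [TopologicalSpace X]
    [TopologicalSpace.MetrizableSpace X] {U : Set X} (hU : IsOpen U) :
    ∃ f : X → ℝ≥0∞, Continuous f ∧ ∀ x, 0 < f x ↔ x ∈ U := by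
  let _ := TopologicalSpace.metrizableSpaceMetric X
  refine ⟨fun x => Metric.infEDist x Uᶜ, Metric.continuous_infEDist, fun x => ?_⟩
  rw [pos_iff_ne_zero, ne_eq, ← Metric.mem_iff_infEDist_zero_of_closed hU.isClosed_compl,
    notMem_compl_iff]

/-- Every point of a space covered by a finite sequence of sets has a first set containing it. -/
lemma exists_first_mem {X : Type*} {n : ℕ} {U : Fin n → Set X} (hU : ⋃ i, U i = univ) (x : X) :
    ∃ i, x ∈ U i ∧ ∀ l < i, x ∉ U l := by
  obtain ⟨i, hi⟩ := mem_iUnion.1 (hU ▸ mem_univ x)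
  obtain ⟨m, hm, hmin⟩ := WellFounded.has_min (wellFounded_lt (α := Fin n)) {i | x ∈ U i} ⟨i, hi⟩
  exact ⟨m, hm, fun l hl hx => hmin l hx hl⟩

/-- Open covers of `X` and `Y` give open sets `W i j ⊆ U i × V j` covering `X × Y` such that
those with a fixed value of `i + j` are pairwise disjoint. -/
lemma exists_prod_cover_disjoint_antidiagonal {X Y : Type*} [TopologicalSpace X]
    [TopologicalSpace Y] [TopologicalSpace.MetrizableSpace X]
    [TopologicalSpace.MetrizableSpace Y] {n m : ℕ} {U : Fin n → Set X} {V : Fin m → Set Y}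
    (hU : ∀ i, IsOpen (U i)) (hUc : ⋃ i, U i = univ)
    (hV : ∀ j, IsOpen (V j)) (hVc : ⋃ j, V j = univ) :
    ∃ W : Fin n × Fin m → Set (X × Y), (∀ p, IsOpen (W p)) ∧ (∀ z, ∃ p, z ∈ W p) ∧
      (∀ p, W p ⊆ U p.1 ×ˢ V p.2) ∧
      ∀ p q z, (p.1 + p.2 : ℕ) = q.1 + q.2 → z ∈ W p → z ∈ W q → p = q := by
  choose u hu hu' using fun i => exists_continuous_pos_iff_mem (hU i)
  choose v hv hv' using fun j => exists_continuous_pos_iff_mem (hV j)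
  let w (p : Fin n × Fin m) (z : X × Y) : ℝ≥0∞ := min (u p.1 z.1) (v p.2 z.2)
  have hw (p) : Continuous (w p) :=
    ((hu p.1).comp continuous_fst).min ((hv p.2).comp continuous_snd)
  refine ⟨fun p => {z | 0 < w p z ∧
    ∀ q : Fin n × Fin m, q ≠ p → (q.1 + q.2 : ℕ) = p.1 + p.2 → w q z < w p z}, ?_, ?_, ?_, ?_⟩
  · intro p
    simp only [ofPred_and, ofPred_forall]
    refine (isOpen_lt continuous_const (hw p)).inter (isOpen_iInter_of_finite fun q =>
      isOpen_iInter_of_finite fun _ => isOpen_iInter_of_finite fun _ => isOpen_lt (hw q) (hw p))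
  · rintro ⟨x, y⟩
    obtain ⟨i, hi, hi'⟩ := exists_first_mem hUc x
    obtain ⟨j, hj, hj'⟩ := exists_first_mem hVc y
    have hpos : 0 < w (i, j) (x, y) := lt_min ((hu' i x).2 hi) ((hv' j y).2 hj)
    refine ⟨(i, j), hpos, fun q hq hsum => lt_of_le_of_lt ?_ hpos⟩
    by_cases h1 : q.1 < i
    · exact (min_le_left _ _).trans (not_lt.1 fun h => hi' _ h1 ((hu' _ _).1 h))
    · have h2 : q.2 < j := by
        rw [Fin.lt_def] at h1 ⊢
        by_contra h2
        simp only at hsum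
        exact hq (Prod.ext (Fin.ext (by dsimp only; omega)) (Fin.ext (by dsimp only; omega)))
      exact (min_le_right _ _).trans (not_lt.1 fun h => hj' _ h2 ((hv' _ _).1 h))
  · rintro p z ⟨hz, -⟩
    rw [lt_min_iff, hu', hv'] at hz
    exact hz
  · rintro p q z hpq ⟨-, hp⟩ ⟨-, hq⟩
    by_contra hne
    exact lt_asymm (hp q (Ne.symm hne) hpq.symm) (hq p hne hpq)

/-- If `p-cat_α X ≤ n` and `cat Y ≤ m`, then the proper category of `X × Y` with respect to the
ray `(α, y₀)` is at most `n + m`. -/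
lemma PCatLE.prod {X Y : Type*} [TopologicalSpace X] [TopologicalSpace Y]
    [TopologicalSpace.MetrizableSpace X] [TopologicalSpace.MetrizableSpace Y]
    [PathConnectedSpace Y] [CompactSpace Y] {α : ℝ≥0 → X} {n m : ℕ}
    (hX : PCatLE α n) (hY : LSCatLE Y m) (y₀ : Y) :
    PCatLE (fun t => ((α t, y₀) : X × Y)) (n + m) := by
  obtain ⟨U, hU, hUc, hUα⟩ := hX
  obtain ⟨V, hV, hVc, hVn⟩ := hY
  obtain ⟨W, hW, hWc, hWs, hWd⟩ := exists_prod_cover_disjoint_antidiagonal hU hUc hV hVc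
  let D (k : Fin (n + m + 1)) : Type := {p : Fin (n + 1) × Fin (m + 1) // (p.1 + p.2 : ℕ) = k}
  obtain ⟨T, hTc, hT, hTs⟩ := exists_iUnion_eq_closure_subset
    (u := fun k => ⋃ p : D k, W p.1) (fun k => isOpen_iUnion fun p => hW _)
    (fun z => Set.toFinite _) (by
      refine eq_univ_of_forall fun z => ?_
      obtain ⟨p, hp⟩ := hWc z
      exact mem_iUnion.2 ⟨⟨p.1 + p.2, by omega⟩, mem_iUnion.2 ⟨⟨p, rfl⟩, hp⟩⟩)
  refine ⟨T, hT, hTc, fun k => ?_⟩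
  have hfin : Finite (D k) := inferInstanceAs (Finite {p : Fin (n + 1) × Fin (m + 1) // _})
  have hdisj (p q : D k) (z : X × Y) (hp : z ∈ W p.1) (hq : z ∈ W q.1) : p = q :=
    Subtype.ext (hWd _ _ z (p.2.trans q.2.symm) hp hq)
  have hcov (z) (hz : z ∈ closure (T k)) : ∃ p : D k, z ∈ W p.1 := mem_iUnion.1 (hTs k hz)
  change ProperlyDeformsTo (fun t => ((α t, y₀) : X × Y)) (closure (T k))
  refine ProperlyDeformsTo.of_disjoint_open_cover (O := fun p : D k => W p.1) (fun p => hW _)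
    hdisj hcov fun p => ?_
  obtain ⟨y₁, hy₁⟩ := hVn p.1.2
  refine ProperlyDeformsTo.of_subset_prod (hUα p.1.1) (hy₁.const_of_pathConnected y₀) ?_
    (fun z hz => subset_closure (hWs _ hz.2).1) fun z hz => (hWs _ hz.2).2
  have h : closure (T k) ∩ W p.1 =
      closure (T k) ∩ (⋃ q : {q : D k // q ≠ p}, W q.1.1)ᶜ := by
    ext z
    refine and_congr_right fun hz => ⟨fun hp hq => ?_, fun hn => ?_⟩
    · obtain ⟨q, hq⟩ := mem_iUnion.1 hq
      exact q.2 (hdisj _ _ z hq hp)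
    · obtain ⟨q, hq⟩ := hcov z hz
      by_cases hqp : q = p
      · exact hqp ▸ hq
      · exact absurd (mem_iUnion.2 ⟨⟨q, hqp⟩, hq⟩) hn
  rw [h]
  exact isClosed_closure.inter (isOpen_iUnion fun q => hW _).isClosed_compl

/-- For `X` Hausdorff, non-compact, σ-compact, locally compact ANR with ray `α`, and `Y`
a path-connected compact ANR with base point `y₀`,
`p-cat_{α'} (X × Y) ≤ p-cat_α X + cat Y` where `α' t = (α t, y₀)`. -/
theorem pCat_prod_le {X : Type u} {Y : Type v} [TopologicalSpace X] [TopologicalSpace Y]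
    [T2Space X] [NoncompactSpace X] [SigmaCompactSpace X] [LocallyCompactSpace X]
    [PathConnectedSpace Y] [CompactSpace Y]
    (hX : IsANR X) (hY : IsANR Y)
    (α : ℝ≥0 → X) (hα : IsProperMap α) (y₀ : Y) :
    pCat (fun t => ((α t, y₀) : X × Y)) ≤ pCat α + lsCat Y := by
  have := hX.1
  have := hY.1
  have attained {s : Set ℕ∞} (hs : sInf s ≠ ⊤) : sInf s ∈ s :=
    csInf_mem (nonempty_iff_ne_empty.2 fun h => hs (by rw [h, sInf_empty]))
  by_cases hn : pCat α = ⊤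
  · simp [hn]
  by_cases hm : lsCat Y = ⊤
  · simp [hm]
  obtain ⟨n, hn, hXn⟩ := attained hn
  obtain ⟨m, hm, hYm⟩ := attained hm
  refine sInf_le ⟨n + m, ?_, hXn.prod hYm y₀⟩
  rw [pCat, lsCat, hn, hm, Nat.cast_add]

end
end

section
/- If X and Y are properly homotopy equivalent ANR spaces, then pTC(X) = pTC(Y); that is, the proper topological complexity is an invariant of the proper homotopy type. -/
open Set unitInterval
open scoped NNReal ENNReal

noncomputable section

universe u v

/-- If `X` is properly dominated by `Y`, the proper topological complexity of `X` is at most that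
of `Y`. -/
theorem PTCLE.of_properlyDominated {X : Type*} {Y : Type*}
    [TopologicalSpace X] [TopologicalSpace Y] {f : X → Y} {g : Y → X}
    (hf : IsProperMap f) (hg : IsProperMap g) (hgf : ProperlyHomotopic (g ∘ f) (id : X → X))
    {n : ℕ} (h : PTCLE Y n) : PTCLE X n := by
  obtain ⟨H, hH, hH0, hH1⟩ := hgf
  obtain ⟨U, hUo, hUc, s, hsc, hse, hsK⟩ := h
  let F : X × X → Y × Y := Prod.map f f
  have hF : Continuous F := hf.continuous.prodMap hf.continuous
  let V : Fin (n + 1) → Set (X × X) := fun i => F ⁻¹' U i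
  let q : (i : Fin (n + 1)) → V i → U i := fun i p => ⟨F p, p.2⟩
  have hq : ∀ i, Continuous (q i) := fun i =>
    (hF.comp continuous_subtype_val).subtype_mk _
  let γ : (x : X) → Path (g (f x)) x := fun x =>
    { toFun := fun t => H (x, t)
      continuous_toFun := hH.continuous.comp (by fun_prop)
      source' := hH0 x
      target' := hH1 x }
  have hγ : Continuous ↿γ := hH.continuous
  let δ : (i : Fin (n + 1)) → (p : V i) → Path (g (f p.1.1)) (g (f p.1.2)) := fun i p =>
    { toFun := fun t => g (s i (q i p) t)
      continuous_toFun := hg.continuous.comp (s i (q i p)).continuous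
      source' := congrArg g (hse i (q i p)).1
      target' := congrArg g (hse i (q i p)).2 }
  have hδ : ∀ i, Continuous ↿(δ i) := fun i =>
    hg.continuous.comp (ContinuousEval.continuous_eval.comp
      (((hsc i).comp ((hq i).comp continuous_fst)).prodMk continuous_snd))
  have hγ₁ : ∀ i, Continuous ↿fun p : V i => (γ p.1.1).symm := fun i =>
    Path.symm_continuous_family (fun p : V i => γ p.1.1)
      (hγ.comp ((continuous_fst.comp (continuous_subtype_val.comp continuous_fst)).prodMk
        continuous_snd))
  have hγ₂ : ∀ i, Continuous ↿fun p : V i => γ p.1.2 := fun i =>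
    hγ.comp ((continuous_snd.comp (continuous_subtype_val.comp continuous_fst)).prodMk
      continuous_snd)
  let c : (i : Fin (n + 1)) → (p : V i) → Path p.1.1 p.1.2 := fun i p =>
    ((γ p.1.1).symm.trans (δ i p)).trans (γ p.1.2)
  have hc : ∀ i, Continuous ↿(c i) := fun i =>
    Path.trans_continuous_family _
      (Path.trans_continuous_family _ (hγ₁ i) _ (hδ i)) _ (hγ₂ i)
  refine ⟨V, fun i => (hUo i).preimage hF, ?_, fun i p => (c i p).toContinuousMap,
    fun i => ContinuousMap.continuous_of_continuous_uncurry _ (hc i),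
    fun i p => ⟨(c i p).source, (c i p).target⟩, fun K hK => ?_⟩
  · rw [← preimage_iUnion, hUc, preimage_univ]
  obtain ⟨L, hL, -, hsL⟩ := hsK (g ⁻¹' K) (hg.isCompact_preimage hK)
  refine ⟨K ∪ (f ⁻¹' L ∪ Prod.fst '' (H ⁻¹' K)),
    hK.union ((hf.isCompact_preimage hL).union
      ((hH.isCompact_preimage hK).image continuous_fst)),
    subset_union_left, fun i p h₁ h₂ t ht => ?_⟩
  simp only [mem_union, not_or] at h₁ h₂
  have hmem : c i p t ∈ range (c i p) := mem_range_self t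
  rw [Path.trans_range, Path.trans_range, Path.symm_range] at hmem
  change c i p t ∈ K at ht
  rcases hmem with (⟨u, hu⟩ | ⟨u, hu⟩) | ⟨u, hu⟩ <;> rw [← hu] at ht
  · exact h₁.2.2 ⟨(p.1.1, u), ht, rfl⟩
  · exact hsL i (q i p) h₁.2.1 h₂.2.1 u ht
  · exact h₂.2.2 ⟨(p.1.2, u), ht, rfl⟩

/-- The proper topological complexity is an invariant of the proper homotopy type. -/
theorem pTC_eq_of_properHomotopyEquiv {X : Type u} {Y : Type v}
    [TopologicalSpace X] [TopologicalSpace Y]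
    (hX : IsANR X) (hY : IsANR Y) (f : X → Y) (hf : IsProperHomotopyEquiv f) :
    pTC X = pTC Y := by
  obtain ⟨hf, g, hg, hgf, hfg⟩ := hf
  have hiff : ∀ n, PTCLE X n ↔ PTCLE Y n := fun _ =>
    ⟨PTCLE.of_properlyDominated hg hf hfg, PTCLE.of_properlyDominated hf hg hgf⟩
  simp only [pTC, hiff]

end
end

section
/- Let X be an ANR space that is Hausdorff, non-compact, σ-compact and locally compact, and let α : [0,∞) → X be a ray of X. Then p-cat_α(X) ≤ pTC(X) ≤ 2·p-cat_α(X). -/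
open Set unitInterval
open scoped NNReal ENNReal

noncomputable section

universe u v

open Topology

theorem exists_isProperMap_nnreal (X : Type*) [TopologicalSpace X] [T2Space X]
    [SigmaCompactSpace X] [LocallyCompactSpace X] : ∃ r : X → ℝ≥0, IsProperMap r := by
  let K := CompactExhaustion.choice X
  obtain ⟨g, hg⟩ := exists_continuous_forall_mem_convex_of_local_const
    (t := fun x : X => Ici (K.find x : ℝ)) (fun x => convex_Ici _) fun x => by
      obtain ⟨n, hn⟩ := K.exists_mem_nhds x
      exact ⟨n, Filter.mem_of_superset hn fun y hy => by
        simpa using K.mem_iff_find_le.1 hy⟩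
  have hc : Continuous fun x => (g x).toNNReal := continuous_real_toNNReal.comp g.continuous
  refine ⟨_, isProperMap_iff_isCompact_preimage.2 ⟨hc, fun S hS => ?_⟩⟩
  obtain ⟨B, hB⟩ := hS.bddAbove
  obtain ⟨n, hn⟩ := exists_nat_ge B
  refine (K.isCompact n).of_isClosed_subset (hS.isClosed.preimage hc) fun x hx => ?_
  have h₁ : (K.find x : ℝ) ≤ g x := hg x
  have h₂ : g x ≤ n := Real.toNNReal_le_natCast.1 ((hB hx).trans hn)
  exact K.mem_iff_find_le.2 (by exact_mod_cast h₁.trans h₂)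

theorem PTCLE.pCatLE {X : Type*} [TopologicalSpace X] [T2Space X] [SigmaCompactSpace X]
    [LocallyCompactSpace X] {α : ℝ≥0 → X} (hα : IsProperMap α) {n : ℕ} (h : PTCLE X n) :
    PCatLE α n := by
  obtain ⟨U, hUo, hU, s, hs, hends, hK⟩ := h
  obtain ⟨r, hr⟩ := exists_isProperMap_nnreal X
  let graph : X → X × X := fun x => (x, α (r x))
  have hgraph : Continuous graph := continuous_id.prodMk (hα.continuous.comp hr.continuous)
  obtain ⟨W, hW, hWo, hWU⟩ := exists_iUnion_eq_closure_subset
    (u := fun i => graph ⁻¹' U i) (fun i => (hUo i).preimage hgraph)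
    (fun x => Set.toFinite _) (by rw [← preimage_iUnion, hU, preimage_univ])
  refine ⟨W, hWo, hW, fun i => ⟨fun x => r x, hr.restrict isClosed_closure,
    fun q => s i ⟨graph q.1, hWU i q.1.2⟩ q.2, ?_, fun x => (hends i _).1,
    fun x => (hends i _).2⟩⟩
  have hc : Continuous fun q : closure (W i) × unitInterval =>
      s i ⟨graph q.1, hWU i q.1.2⟩ q.2 :=
    ((hs i).comp ((hgraph.comp (continuous_subtype_val.comp continuous_fst)).subtype_mk
      _)).eval continuous_snd
  refine isProperMap_iff_isCompact_preimage.2 ⟨hc, fun K hKc => ?_⟩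
  obtain ⟨L, hL, -, hLK⟩ := hK K hKc
  have hM : IsCompact (L ∪ (α ∘ r) ⁻¹' L) := hL.union ((hα.comp hr).isCompact_preimage hL)
  refine ((isClosed_closure.isProperMap_subtypeVal.isCompact_preimage hM).prod
    (isCompact_univ (X := unitInterval))).of_isClosed_subset (hKc.isClosed.preimage hc) ?_
  rintro ⟨x, t⟩ hx
  refine ⟨?_, mem_univ _⟩
  by_contra hxM
  rw [mem_preimage, mem_union, not_or] at hxM
  exact hLK i ⟨graph x, hWU i x.2⟩ hxM.1 hxM.2 t hx

/-- The paths which follow `H` from `x` to `α (r x)`, then `α` to `α (r' y)`, then `H'` back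
to `y`. -/
theorem exists_continuousMap_paths_along_ray {X C D : Type*} [TopologicalSpace X]
    [TopologicalSpace C] [TopologicalSpace D] {α : ℝ≥0 → X} (hα : Continuous α)
    {f : C → X} {r : C → ℝ≥0} (hr : Continuous r) {H : C × unitInterval → X}
    (hH : Continuous H) (hH₀ : ∀ x, H (x, 0) = f x) (hH₁ : ∀ x, H (x, 1) = α (r x))
    {g : D → X} {r' : D → ℝ≥0} (hr' : Continuous r') {H' : D × unitInterval → X}
    (hH' : Continuous H') (hH'₀ : ∀ y, H' (y, 0) = g y) (hH'₁ : ∀ y, H' (y, 1) = α (r' y)) :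
    ∃ φ : C(C × D, C(unitInterval, X)), ∀ p : C × D, φ p 0 = f p.1 ∧ φ p 1 = g p.2 ∧
      ∀ t, (∃ u, H (p.1, u) = φ p t) ∨ (∃ z, (r p.1 ≤ z ∨ r' p.2 ≤ z) ∧ α z = φ p t) ∨
        ∃ u, H' (p.2, u) = φ p t := by
  let γ₁ (p : C × D) : Path (f p.1) (α (r p.1)) :=
    ⟨⟨fun t => H (p.1, t), by fun_prop⟩, hH₀ _, hH₁ _⟩
  let γ₂ (p : C × D) : Path (α (r p.1)) (α (r' p.2)) :=
    ⟨⟨fun t => α (toNNReal (σ t) * r p.1 + toNNReal t * r' p.2), by fun_prop⟩,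
      by simp, by simp⟩
  let γ₃ (p : C × D) : Path (g p.2) (α (r' p.2)) :=
    ⟨⟨fun t => H' (p.2, t), by fun_prop⟩, hH'₀ _, hH'₁ _⟩
  have h₁ : Continuous ↿γ₁ :=
    hH.comp ((continuous_fst.comp continuous_fst).prodMk continuous_snd)
  have h₂ : Continuous ↿γ₂ := by
    change Continuous fun q : (C × D) × unitInterval =>
      α (toNNReal (σ q.2) * r q.1.1 + toNNReal q.2 * r' q.1.2)
    fun_prop
  have h₃ : Continuous ↿γ₃ :=
    hH'.comp ((continuous_snd.comp continuous_fst).prodMk continuous_snd)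
  let γ (p : C × D) := (γ₁ p).trans ((γ₂ p).trans (γ₃ p).symm)
  have hγ : Continuous ↿γ := Path.trans_continuous_family _ h₁ _
    (Path.trans_continuous_family _ h₂ _ (Path.symm_continuous_family _ h₃))
  refine ⟨ContinuousMap.curry ⟨_, hγ⟩, fun p => ⟨(γ p).source, (γ p).target, fun t => ?_⟩⟩
  have ht : γ p t ∈ range (γ p) := mem_range_self t
  rw [Path.trans_range, Path.trans_range, Path.symm_range] at ht
  rcases ht with ⟨u, hu⟩ | ⟨u, hu⟩ | ⟨u, hu⟩
  · exact .inl ⟨u, hu⟩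
  · refine .inr (.inl ⟨_, ?_, hu⟩)
    rcases le_total (r p.1) (r' p.2) with h | h
    · left
      calc r p.1 = toNNReal (σ u) * r p.1 + toNNReal u * r p.1 := by
            rw [← add_mul, toNNReal_symm_add_toNNReal, one_mul]
        _ ≤ _ := by gcongr
    · right
      calc r' p.2 = toNNReal (σ u) * r' p.2 + toNNReal u * r' p.2 := by
            rw [← add_mul, toNNReal_symm_add_toNNReal, one_mul]
        _ ≤ _ := by gcongr
  · exact .inr (.inr ⟨u, hu⟩)

/-- Outside a compact set, the tracks of a proper homotopy and the tails of a ray avoid any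
prescribed compact set. -/
theorem exists_isCompact_forall_notMem {X : Type*} [TopologicalSpace X] {α : ℝ≥0 → X}
    (hα : IsProperMap α) {C : Set X} {r : C → ℝ≥0} (hr : IsProperMap r)
    {H : C × unitInterval → X} (hH : IsProperMap H) {K : Set X} (hK : IsCompact K) :
    ∃ L : Set X, IsCompact L ∧ ∀ x : C, (x : X) ∉ L →
      (∀ t, H (x, t) ∉ K) ∧ ∀ z, r x ≤ z → α z ∉ K := by
  obtain ⟨B, hB⟩ := (hα.isCompact_preimage hK).bddAbove
  refine ⟨(fun q => (q.1 : X)) '' (H ⁻¹' K) ∪ (↑) '' (r ⁻¹' Icc 0 B),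
    ((hH.isCompact_preimage hK).image (continuous_subtype_val.comp continuous_fst)).union
      ((hr.isCompact_preimage isCompact_Icc).image continuous_subtype_val),
    fun x hx => ⟨fun t ht => hx (.inl ⟨(x, t), ht, rfl⟩), fun z hz hzK => ?_⟩⟩
  exact hx (.inr ⟨x, ⟨zero_le, hz.trans (hB hzK)⟩, rfl⟩)

/-- The products of the members of an open cover by `m + 1` sets are refined by `2 * m + 1`
families of pairwise disjoint open sets which together cover the product. -/
theorem exists_pairwise_disjoint_refinement_prod {X : Type*} [TopologicalSpace X] [T2Space X]
    [ParacompactSpace X] {m : ℕ} {U : Fin (m + 1) → Set X} (hUo : ∀ i, IsOpen (U i))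
    (hU : ⋃ i, U i = univ) :
    ∃ V : Fin (2 * m + 1) → Finset (Fin (m + 1) ⊕ Fin (m + 1)) → Set (X × X),
      (∀ k A, IsOpen (V k A)) ∧ (⋃ k, ⋃ A, V k A) = univ ∧
      (∀ k, Pairwise fun A B => Disjoint (V k A) (V k B)) ∧
      ∀ k A, ∃ i j, V k A ⊆ U i ×ˢ U j := by
  classical
  obtain ⟨f, hf⟩ := PartitionOfUnity.exists_isSubordinate isClosed_univ U hUo hU.ge
  have hfU (i x) (hx : 0 < f i x) : x ∈ U i := hf i (subset_tsupport _ hx.ne')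
  let h : Fin (m + 1) ⊕ Fin (m + 1) → X × X → ℝ :=
    Sum.elim (fun i p => f i p.1) (fun j p => f j p.2)
  have hh (a) : Continuous (h a) := by
    rcases a with i | i
    · exact (f i).continuous.comp continuous_fst
    · exact (f i).continuous.comp continuous_snd
  have hnn (a p) : 0 ≤ h a p := by
    rcases a with i | i
    · exact f.nonneg i _
    · exact f.nonneg i _
  refine ⟨fun k A => {p | (A.card = k + 2 ∧ (∃ i, Sum.inl i ∈ A) ∧ ∃ j, Sum.inr j ∈ A) ∧
    ∀ a, a ∈ A → 0 < h a p ∧ ∀ b, b ∉ A → h b p < h a p}, ?_, ?_, ?_, ?_⟩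
  · intro k A
    refine isOpen_const.and ?_
    simp only [ofPred_forall]
    refine isOpen_iInter_of_finite fun a => isOpen_iInter_of_finite fun _ => ?_
    refine (isOpen_lt continuous_const (hh a)).and ?_
    simp only [ofPred_forall]
    exact isOpen_iInter_of_finite fun b => isOpen_iInter_of_finite fun _ =>
      isOpen_lt (hh b) (hh a)
  · refine eq_univ_of_forall fun p => ?_
    obtain ⟨i, hi⟩ := f.exists_pos (mem_univ p.1)
    obtain ⟨j, hj⟩ := f.exists_pos (mem_univ p.2)
    let A : Finset (Fin (m + 1) ⊕ Fin (m + 1)) := {a | 0 < h a p}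
    have hi : Sum.inl i ∈ A := by simpa [A, h] using hi
    have hj : Sum.inr j ∈ A := by simpa [A, h] using hj
    have h₁ : 1 < A.card := Finset.one_lt_card.2 ⟨_, hi, _, hj, Sum.inl_ne_inr⟩
    have h₂ : A.card ≤ (m + 1) + (m + 1) := by simpa using A.card_le_univ
    refine mem_iUnion.2 ⟨⟨A.card - 2, by lia⟩, mem_iUnion.2 ⟨A, ⟨by simp; lia, ⟨i, hi⟩,
      ⟨j, hj⟩⟩, fun a ha => ?_⟩⟩
    have ha : 0 < h a p := by simpa [A] using ha
    refine ⟨ha, fun b hb => lt_of_le_of_lt ?_ ha⟩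
    simpa [A] using hb
  · intro k A B hAB
    refine disjoint_left.2 fun p hA hB => hAB ?_
    by_contra hne
    have hcard : A.card = B.card := hA.1.1.trans hB.1.1.symm
    obtain ⟨a, ha, haB⟩ := Finset.not_subset.1
      fun hs : A ⊆ B => hne (Finset.eq_of_subset_of_card_le hs hcard.ge)
    obtain ⟨b, hb, hbA⟩ := Finset.not_subset.1
      fun hs : B ⊆ A => hne (Finset.eq_of_subset_of_card_le hs hcard.le).symm
    exact lt_asymm ((hA.2 a ha).2 b hbA) ((hB.2 b hb).2 a haB)
  · intro k A
    by_cases hA : (∃ i, Sum.inl i ∈ A) ∧ ∃ j, Sum.inr j ∈ A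
    · obtain ⟨⟨i, hi⟩, j, hj⟩ := hA
      exact ⟨i, j, fun p hp => ⟨hfU i _ (hp.2 _ hi).1, hfU j _ (hp.2 _ hj).1⟩⟩
    · exact ⟨0, 0, fun p hp => absurd hp.1.2 hA⟩

theorem exists_continuousMap_iUnion_of_pairwise_disjoint {Z E ι : Type*} [TopologicalSpace Z]
    [TopologicalSpace E] {V : ι → Set Z} (hV : ∀ a, IsOpen (V a))
    (hdisj : Pairwise fun a b => Disjoint (V a) (V b)) (φ : ∀ a, C(V a, E)) :
    ∃ s : C(⋃ a, V a, E), ∀ (a : ι) (p : Z) (hp : p ∈ V a),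
      s ⟨p, mem_iUnion_of_mem a hp⟩ = φ a ⟨p, hp⟩ := by
  let S (a : ι) : Set (⋃ a, V a) := (↑) ⁻¹' V a
  let ψ (a : ι) : C(S a, E) := (φ a).comp ⟨fun p => ⟨p.1.1, p.2⟩, by fun_prop⟩
  refine ⟨ContinuousMap.liftCover S ψ ?_ ?_, fun a p hp => ?_⟩
  · intro a b x hxa hxb
    obtain rfl : a = b := by
      by_contra hab
      exact disjoint_left.1 (hdisj hab) hxa hxb
    rfl
  · intro x
    obtain ⟨a, ha⟩ := mem_iUnion.1 x.2
    exact ⟨a, ((hV a).preimage continuous_subtype_val).mem_nhds ha⟩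
  · exact ContinuousMap.liftCover_coe (S := S) (φ := ψ) (i := a)
      ⟨⟨p, mem_iUnion_of_mem a hp⟩, hp⟩

theorem PCatLE.pTCLE {X : Type*} [TopologicalSpace X] [T2Space X] [ParacompactSpace X]
    {α : ℝ≥0 → X} (hα : IsProperMap α) {m : ℕ} (h : PCatLE α m) : PTCLE X (2 * m) := by
  obtain ⟨U, hUo, hU, h⟩ := h
  choose r hr H hH hH₀ hH₁ using h
  obtain ⟨V, hVo, hV, hdisj, hVU⟩ := exists_pairwise_disjoint_refinement_prod hUo hU
  choose i j hij using hVU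
  choose φ hφ using fun i j => exists_continuousMap_paths_along_ray hα.continuous
    (hr i).continuous (hH i).continuous (hH₀ i) (hH₁ i)
    (hr j).continuous (hH j).continuous (hH₀ j) (hH₁ j)
  let e (k A) : C(V k A, closure (U (i k A)) × closure (U (j k A))) :=
    ⟨fun p => (⟨p.1.1, subset_closure (hij k A p.2).1⟩,
      ⟨p.1.2, subset_closure (hij k A p.2).2⟩), by fun_prop⟩
  choose s hs using fun k => exists_continuousMap_iUnion_of_pairwise_disjoint (hVo k) (hdisj k)
    fun A => (φ (i k A) (j k A)).comp (e k A)
  refine ⟨fun k => ⋃ A, V k A, fun k => isOpen_iUnion (hVo k), hV, fun k => s k,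
    fun k => (s k).continuous, ?_, fun K hK => ?_⟩
  · rintro k ⟨p, hp⟩
    obtain ⟨A, hA⟩ := mem_iUnion.1 hp
    beta_reduce
    rw [hs k A p hA]
    exact ⟨(hφ _ _ (e k A ⟨p, hA⟩)).1, (hφ _ _ (e k A ⟨p, hA⟩)).2.1⟩
  · choose L hL hLK using fun i => exists_isCompact_forall_notMem hα (hr i) (hH i) hK
    refine ⟨K ∪ ⋃ i, L i, hK.union (isCompact_iUnion hL), subset_union_left, ?_⟩
    rintro k ⟨p, hp⟩ h₁ h₂ t
    obtain ⟨A, hA⟩ := mem_iUnion.1 hp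
    beta_reduce
    rw [hs k A p hA]
    have h₁ := hLK (i k A) (e k A ⟨p, hA⟩).1 fun hp => h₁ (.inr (mem_iUnion_of_mem _ hp))
    have h₂ := hLK (j k A) (e k A ⟨p, hA⟩).2 fun hp => h₂ (.inr (mem_iUnion_of_mem _ hp))
    rw [ContinuousMap.comp_apply]
    rcases (hφ _ _ (e k A ⟨p, hA⟩)).2.2 t with ⟨u, hu⟩ | ⟨z, hz | hz, hu⟩ | ⟨u, hu⟩
    · exact hu ▸ h₁.1 u
    · exact hu ▸ h₁.2 z hz
    · exact hu ▸ h₂.2 z hz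
    · exact hu ▸ h₂.1 u

/-- For a Hausdorff, non-compact, σ-compact, locally compact ANR space `X` with ray `α`,
`p-cat_α X ≤ pTC X ≤ 2 ⬝ p-cat_α X`. -/
theorem pCat_le_pTC_le {X : Type u} [TopologicalSpace X]
    [T2Space X] [NoncompactSpace X] [SigmaCompactSpace X] [LocallyCompactSpace X]
    (hX : IsANR X) (α : ℝ≥0 → X) (hα : IsProperMap α) :
    pCat α ≤ pTC X ∧ pTC X ≤ 2 * pCat α := by
  refine ⟨le_sInf ?_, ?_⟩
  · rintro _ ⟨n, rfl, hn⟩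
    exact sInf_le ⟨n, rfl, hn.pCatLE hα⟩
  · rcases eq_empty_or_nonempty {n : ℕ∞ | ∃ m : ℕ, n = (m : ℕ∞) ∧ PCatLE α m} with h | h
    · simp [pCat, h]
    · obtain ⟨m, hm, hcat⟩ := csInf_mem h
      rw [pCat, hm]
      exact sInf_le ⟨2 * m, by norm_cast, hcat.pTCLE hα⟩

end
end

section
/- For any non-empty compact ANR space X, pTC(X × [0,∞)) = TC(X). -/
open Set unitInterval
open scoped NNReal ENNReal

noncomputable section

universe u v

/-- Straight-line interpolation between two points of the half-line. -/
def halfLineSegment (a b : ℝ≥0) (t : unitInterval) : ℝ≥0 :=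
  unitInterval.toNNReal (unitInterval.symm t) * a + unitInterval.toNNReal t * b

theorem continuous_halfLineSegment :
    Continuous fun q : (ℝ≥0 × ℝ≥0) × unitInterval => halfLineSegment q.1.1 q.1.2 q.2 := by
  have h : Continuous unitInterval.toNNReal := unitInterval.toNNReal_continuous
  unfold halfLineSegment
  fun_prop

theorem lt_halfLineSegment {N a b : ℝ≥0} (ha : N < a) (hb : N < b) (t : unitInterval) :
    N < halfLineSegment a b t := by
  have ha' : (N : ℝ) < a := ha
  have hb' : (N : ℝ) < b := hb
  have key : (N : ℝ) < (1 - (t : ℝ)) * a + (t : ℝ) * b :=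
    (convex_Ioi (N : ℝ)) ha' hb' (sub_nonneg.2 t.2.2) t.2.1 (sub_add_cancel _ _)
  exact key

/-- Pulling back along `x ↦ (x, 0)` and projecting paths turns proper motion planners on
`X × [0, ∞)` into motion planners on `X`. -/
theorem TCLE_of_PTCLE_prod_halfLine {X : Type*} [TopologicalSpace X] {n : ℕ}
    (h : PTCLE (X × ℝ≥0) n) : TCLE X n := by
  obtain ⟨U, hU, hcov, s, hs, hends, -⟩ := h
  let j : X × X → (X × ℝ≥0) × (X × ℝ≥0) := fun p => ((p.1, 0), (p.2, 0))
  have hj : Continuous j := by fun_prop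
  refine ⟨fun i => j ⁻¹' U i, fun i => (hU i).preimage hj, ?_, fun i => ?_⟩
  · rw [← preimage_iUnion, hcov, preimage_univ]
  · refine ⟨fun p => (ContinuousMap.fst).comp (s i ⟨j p, p.2⟩), ?_, fun p => ?_⟩
    · exact (ContinuousMap.continuous_postcomp _).comp ((hs i).comp (by fun_prop))
    · have := hends i ⟨j p, p.2⟩
      exact ⟨congrArg Prod.fst this.1, congrArg Prod.fst this.2⟩

/-- Over a compact space, motion planners on `X` combined with linear interpolation in the
half-line are proper motion planners on `X × [0, ∞)`. -/
theorem PTCLE_prod_halfLine_of_TCLE {X : Type*} [TopologicalSpace X] [CompactSpace X] {n : ℕ}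
    (h : TCLE X n) : PTCLE (X × ℝ≥0) n := by
  obtain ⟨U, hU, hcov, h⟩ := h
  choose s hs hends using h
  let π : (X × ℝ≥0) × (X × ℝ≥0) → X × X := fun p => (p.1.1, p.2.1)
  have hπ : Continuous π := by fun_prop
  have hcont (i : Fin (n + 1)) :
      Continuous fun q : (π ⁻¹' U i) × unitInterval =>
        (s i ⟨π q.1, q.1.2⟩ q.2, halfLineSegment q.1.1.1.2 q.1.1.2.2 q.2) := by
    refine .prodMk ?_ ?_
    · have h₁ : Continuous fun q : (π ⁻¹' U i) × unitInterval =>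
          s i ⟨π q.1, q.1.2⟩ := (hs i).comp (by fun_prop)
      exact h₁.eval continuous_snd
    · exact continuous_halfLineSegment.comp
        (f := fun q : (π ⁻¹' U i) × unitInterval => ((q.1.1.1.2, q.1.1.2.2), q.2)) (by fun_prop)
  refine ⟨fun i => π ⁻¹' U i, fun i => (hU i).preimage hπ, ?_,
    fun i => ContinuousMap.curry ⟨_, hcont i⟩, fun i => ContinuousMap.continuous _,
    fun i p => ?_, fun K hK => ?_⟩
  · rw [← preimage_iUnion, hcov, preimage_univ]
  · have := hends i ⟨π p, p.2⟩
    constructor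
    · refine Prod.ext this.1 ?_
      simp [halfLineSegment]
    · refine Prod.ext this.2 ?_
      simp [halfLineSegment]
  · obtain ⟨N, hN⟩ := (hK.image continuous_snd).bddAbove
    refine ⟨univ ×ˢ Icc 0 N, isCompact_univ.prod isCompact_Icc,
      fun p hp => ⟨trivial, zero_le, hN (mem_image_of_mem _ hp)⟩, fun i p hx hy t ht => ?_⟩
    have hx' : N < p.1.1.2 := by simpa using hx
    have hy' : N < p.1.2.2 := by simpa using hy
    exact (lt_halfLineSegment hx' hy' t).not_ge (hN (mem_image_of_mem Prod.snd ht))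

/-- For any non-empty compact ANR space `X`, `pTC (X × [0, ∞)) = TC X`. -/
theorem pTC_prod_halfLine {X : Type u} [TopologicalSpace X] [Nonempty X] [CompactSpace X]
    (hX : IsANR X) :
    pTC (X × ℝ≥0) = TC' X := by
  have h (m : ℕ) : PTCLE (X × ℝ≥0) m ↔ TCLE X m :=
    ⟨TCLE_of_PTCLE_prod_halfLine, PTCLE_prod_halfLine_of_TCLE⟩
  simp only [pTC, TC', h]

end
end

section
/- For any non-empty compact ANR space X with a chosen base point x₀, pTC(X ∨ [0,∞)) = TC(X), where X ∨ [0,∞) denotes the wedge obtained as the quotient of the disjoint union of X and [0,∞) identifying x₀ ∈ X with 0 ∈ [0,∞). -/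
open Set unitInterval
open scoped NNReal ENNReal

noncomputable section

universe u v

/-- A cover by domains of continuous motion planners, the planners being total functions. -/
theorem TCLE.exists_continuousOn {X : Type*} [TopologicalSpace X] {n : ℕ} (h : TCLE X n) :
    ∃ (U : Fin (n + 1) → Set (X × X)) (F : Fin (n + 1) → X × X → unitInterval → X),
      (∀ i, IsOpen (U i)) ∧ (⋃ i, U i) = Set.univ ∧
      (∀ i, ContinuousOn (Function.uncurry (F i)) (U i ×ˢ Set.univ)) ∧
      ∀ i, ∀ p ∈ U i, F i p 0 = p.1 ∧ F i p 1 = p.2 := by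
  classical
  obtain ⟨U, hU, hcov, hs⟩ := h
  choose s hsc hse using hs
  refine ⟨U, fun i p t => if hp : p ∈ U i then s i ⟨p, hp⟩ t else p.1, hU, hcov, ?_, ?_⟩
  · intro i
    rw [continuousOn_iff_continuous_domRestrict]
    have hc : Continuous fun q : (U i ×ˢ (Set.univ : Set unitInterval) : Set _) =>
        s i ⟨q.1.1, q.2.1⟩ q.1.2 := by
      have := hsc i
      fun_prop
    convert hc using 2 with q
    simp [Function.uncurry, q.2.1]
  · intro i p hp
    simpa [hp] using hse i ⟨p, hp⟩

/-- Proper motion planners transport along homeomorphisms. -/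
theorem PTCLE.of_homeomorph {A B : Type*} [TopologicalSpace A] [TopologicalSpace B] {n : ℕ}
    (e : A ≃ₜ B) (h : PTCLE A n) : PTCLE B n := by
  obtain ⟨U, hU, hcov, s, hsc, hse, hsK⟩ := h
  refine ⟨fun i => Prod.map e.symm e.symm ⁻¹' U i, fun i => (hU i).preimage (by fun_prop), ?_,
    fun i p => (e : C(A, B)).comp (s i ⟨Prod.map e.symm e.symm p, p.2⟩), ?_, ?_, ?_⟩
  · rw [← Set.preimage_iUnion, hcov, Set.preimage_univ]
  · intro i
    have := hsc i
    exact (ContinuousMap.continuous_postcomp _).comp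
      (this.comp (Continuous.subtype_mk (by fun_prop) _))
  · intro i p
    have := hse i ⟨Prod.map e.symm e.symm p, p.2⟩
    simp [this.1, this.2]
  · intro K hK
    obtain ⟨L, hL, hKL, hsL⟩ := hsK (e ⁻¹' K) (e.isCompact_preimage.2 hK)
    refine ⟨e.symm ⁻¹' L, e.symm.isCompact_preimage.2 hL, fun b hb => hKL (by simpa using hb), ?_⟩
    intro i p h1 h2 t
    exact hsL i ⟨Prod.map e.symm e.symm p, p.2⟩ h1 h2 t

/-- The wedge `X ∨ [0, ∞)` realised inside the product `X × [0, ∞)`. -/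
abbrev Whisker {X : Type*} (x₀ : X) := {p : X × ℝ≥0 // p.1 = x₀ ∨ p.2 = 0}

theorem isClosed_whisker {X : Type*} [TopologicalSpace X] [T1Space X] (x₀ : X) :
    IsClosed {p : X × ℝ≥0 | p.1 = x₀ ∨ p.2 = 0} :=
  (isClosed_singleton.preimage continuous_fst).union (isClosed_singleton.preimage continuous_snd)

/-- The comparison map from the disjoint union onto the wedge inside the product. -/
def sumToWhisker {X : Type*} (x₀ : X) : X ⊕ ℝ≥0 → Whisker x₀ :=
  Sum.elim (fun x => ⟨(x, 0), Or.inr rfl⟩) (fun r => ⟨(x₀, r), Or.inl rfl⟩)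

theorem isQuotientMap_sumToWhisker {X : Type*} [TopologicalSpace X] [T1Space X] (x₀ : X) :
    Topology.IsQuotientMap (sumToWhisker x₀) := by
  have hl : Topology.IsClosedEmbedding fun x : X => (⟨(x, 0), Or.inr rfl⟩ : Whisker x₀) := by
    refine Topology.IsClosedEmbedding.of_continuous_injective_isClosedMap (by fun_prop)
      (fun a b h => by simpa using h) fun C hC => ?_
    have : (fun x : X => (⟨(x, 0), Or.inr rfl⟩ : Whisker x₀)) '' C =
        {p | p.1.1 ∈ C} ∩ {p | p.1.2 = 0} := by
      ext ⟨⟨x, r⟩, hp⟩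
      simp only [mem_image, Subtype.mk.injEq, Prod.mk.injEq, mem_inter_iff, mem_ofPred_eq]
      constructor
      · rintro ⟨a, ha, rfl, rfl⟩
        exact ⟨ha, rfl⟩
      · rintro ⟨ha, rfl⟩
        exact ⟨x, ha, rfl, rfl⟩
    rw [this]
    exact (hC.preimage (by fun_prop)).inter
      ((isClosed_singleton (x := (0 : ℝ≥0))).preimage
        (f := fun p : Whisker x₀ => p.1.2) (by fun_prop))
  have hr : Topology.IsClosedEmbedding fun r : ℝ≥0 => (⟨(x₀, r), Or.inl rfl⟩ : Whisker x₀) := by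
    refine Topology.IsClosedEmbedding.of_continuous_injective_isClosedMap (by fun_prop)
      (fun a b h => by simpa using h) fun C hC => ?_
    have : (fun r : ℝ≥0 => (⟨(x₀, r), Or.inl rfl⟩ : Whisker x₀)) '' C =
        {p | p.1.2 ∈ C} ∩ {p | p.1.1 = x₀} := by
      ext ⟨⟨x, r⟩, hp⟩
      simp only [mem_image, Subtype.mk.injEq, Prod.mk.injEq, mem_inter_iff, mem_ofPred_eq]
      constructor
      · rintro ⟨a, ha, rfl, rfl⟩
        exact ⟨ha, rfl⟩
      · rintro ⟨ha, rfl⟩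
        exact ⟨r, ha, rfl, rfl⟩
    rw [this]
    exact (hC.preimage (by fun_prop)).inter
      ((isClosed_singleton (x := x₀)).preimage
        (f := fun p : Whisker x₀ => p.1.1) (by fun_prop))
  refine IsClosedMap.isQuotientMap (hl.isClosedMap.sumElim hr.isClosedMap)
    (hl.continuous.sumElim hr.continuous) ?_
  rintro ⟨⟨x, r⟩, h⟩
  rcases h with h | h
  · exact ⟨Sum.inr r, by simp only at h; subst h; rfl⟩
  · exact ⟨Sum.inl x, by simp only at h; subst h; rfl⟩

/-- The quotient space `X ∨ [0, ∞)` is homeomorphic to its model inside `X × [0, ∞)`. -/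
theorem nonempty_homeomorph_wedge {X : Type*} [TopologicalSpace X] [T1Space X] (x₀ : X) :
    Nonempty (Whisker x₀ ≃ₜ Wedge X ℝ≥0 x₀ 0) := by
  have hq := isQuotientMap_sumToWhisker x₀
  let f : Wedge X ℝ≥0 x₀ 0 → Whisker x₀ := Quot.lift (sumToWhisker x₀) (by
    rintro _ _ ⟨rfl, rfl⟩
    rfl)
  have hf : Topology.IsQuotientMap f :=
    Topology.IsQuotientMap.of_comp continuous_quot_mk (continuous_quot_lift _ hq.continuous) hq
  have glue : (Quot.mk _ (Sum.inl x₀) : Wedge X ℝ≥0 x₀ 0) = Quot.mk _ (Sum.inr 0) :=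
    Quot.sound ⟨rfl, rfl⟩
  have hinj : Function.Injective f := by
    rintro ⟨a | a⟩ ⟨b | b⟩ hab <;>
      simp only [f, sumToWhisker, Sum.elim_inl, Sum.elim_inr, Subtype.mk.injEq,
        Prod.mk.injEq, and_true, true_and] at hab
    · rw [hab]
    · obtain ⟨rfl, rfl⟩ := hab
      exact glue
    · obtain ⟨rfl, rfl⟩ := hab
      exact glue.symm
    · rw [hab]
  exact ⟨((isHomeomorph_iff_isQuotientMap_injective.2 ⟨hf, hinj⟩).homeomorph f).symm⟩

/-- The height along a path descending from `a` to `μ` and then ascending to `b`. -/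
def pathHeight (a b μ : ℝ≥0) (t : unitInterval) : ℝ≥0 :=
  max μ (max (a * Real.toNNReal (1 - 3 * t)) (b * Real.toNNReal (3 * t - 2)))

/-- The time change which runs through the unit interval during its middle third. -/
def middleThird (t : unitInterval) : unitInterval :=
  Set.projIcc 0 1 zero_le_one (3 * (t : ℝ) - 1)

theorem continuous_middleThird : Continuous middleThird :=
  continuous_projIcc.comp (by fun_prop)

/-- A horizontal motion in `X` together with a height `μ` at which to perform it yields a motion
in the wedge: first change the height to `μ`, then move in `X`, then change the height again. -/
theorem whisker_path_mem {X : Type*} {x₀ : X} (p q : Whisker x₀) (τ : unitInterval → X)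
    (μ : ℝ≥0) (h0 : τ 0 = p.1.1) (h1 : τ 1 = q.1.1) (hτ : μ ≠ 0 → ∀ t, τ t = x₀)
    (t : unitInterval) : τ (middleThird t) = x₀ ∨ pathHeight p.1.2 q.1.2 μ t = 0 := by
  by_cases hμ : μ = 0
  swap
  · exact Or.inl (hτ hμ _)
  subst hμ
  by_cases ht : 3 * (t : ℝ) ≤ 1
  · have hm : middleThird t = 0 := Set.projIcc_of_le_left _ (by linarith)
    rcases p.2 with hp | hp
    · exact Or.inl (by rw [hm, h0, hp])
    · right
      have : Real.toNNReal (3 * t - 2) = 0 := Real.toNNReal_of_nonpos (by linarith)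
      simp [pathHeight, hp, this]
  push Not at ht
  have h3 : Real.toNNReal (1 - 3 * t) = 0 := Real.toNNReal_of_nonpos (by linarith)
  by_cases ht' : 2 ≤ 3 * (t : ℝ)
  · have hm : middleThird t = 1 := Set.projIcc_of_right_le _ (by linarith)
    rcases q.2 with hq | hq
    · exact Or.inl (by rw [hm, h1, hq])
    · right
      simp [pathHeight, hq, h3]
  · right
    have : Real.toNNReal (3 * t - 2) = 0 := Real.toNNReal_of_nonpos (by linarith)
    simp [pathHeight, this, h3]

/-- A criterion for proper motion planning in the wedge in terms of horizontal motions `F i` and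
of the heights `μ i` at which they are performed. -/
theorem PTCLE.whisker {X : Type*} [TopologicalSpace X] [CompactSpace X] [T1Space X] {x₀ : X}
    {n : ℕ} (U : Fin (n + 1) → Set (Whisker x₀ × Whisker x₀)) (hU : ∀ i, IsOpen (U i))
    (hcov : (⋃ i, U i) = Set.univ)
    (F : Fin (n + 1) → Whisker x₀ × Whisker x₀ → unitInterval → X)
    (hF : ∀ i, ContinuousOn (Function.uncurry (F i)) (U i ×ˢ Set.univ))
    (μ : Fin (n + 1) → Whisker x₀ × Whisker x₀ → ℝ≥0) (hμ : ∀ i, ContinuousOn (μ i) (U i))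
    (h0 : ∀ i, ∀ p ∈ U i, F i p 0 = p.1.1.1) (h1 : ∀ i, ∀ p ∈ U i, F i p 1 = p.2.1.1)
    (hle : ∀ i p, μ i p ≤ min p.1.1.2 p.2.1.2)
    (hconst : ∀ i, ∀ p ∈ U i, μ i p ≠ 0 → ∀ t, F i p t = x₀)
    (hproper : ∀ M : ℝ≥0, ∃ M', M ≤ M' ∧ ∀ i, ∀ p ∈ U i, M' < p.1.1.2 → M' < p.2.1.2 →
      M < μ i p) :
    PTCLE (Whisker x₀) n := by
  have hF' : ∀ i, Continuous fun q : U i × unitInterval => F i q.1 (middleThird q.2) := by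
    intro i
    exact (hF i).comp_continuous (f := fun q : U i × unitInterval => (q.1.1, middleThird q.2))
      (by have := continuous_middleThird; fun_prop) (fun q => ⟨q.1.2, mem_univ _⟩)
  have hμ' : ∀ i, Continuous fun q : U i => μ i q := fun i =>
    continuousOn_iff_continuous_domRestrict.1 (hμ i)
  let g : (i : Fin (n + 1)) → U i × unitInterval → Whisker x₀ := fun i q =>
    ⟨(F i q.1 (middleThird q.2), pathHeight q.1.1.1.1.2 q.1.1.2.1.2 (μ i q.1) q.2),
      whisker_path_mem _ _ (F i q.1) _ (h0 i _ q.1.2) (h1 i _ q.1.2) (hconst i _ q.1.2) _⟩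
  have hg : ∀ i, Continuous (g i) := by
    intro i
    refine Continuous.subtype_mk ((hF' i).prodMk ?_) _
    have hr := continuous_real_toNNReal
    unfold pathHeight
    refine ((hμ' i).comp continuous_fst).max (Continuous.max ?_ ?_)
    · exact Continuous.mul (by fun_prop) (hr.comp (by fun_prop))
    · exact Continuous.mul (by fun_prop) (hr.comp (by fun_prop))
  refine ⟨U, hU, hcov, fun i p => ⟨fun t => g i (p, t), (hg i).comp (by fun_prop)⟩, ?_, ?_, ?_⟩
  · exact fun i => ContinuousMap.continuous_of_continuous_uncurry _ (hg i)
  · rintro i ⟨p, hp⟩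
    have hle' := le_min_iff.1 (hle i p)
    have hm0 : middleThird 0 = 0 := Set.projIcc_of_le_left _ (by simp)
    have hm1 : middleThird 1 = 1 := Set.projIcc_of_right_le _ (by norm_num)
    constructor <;> apply Subtype.ext <;> apply Prod.ext
    · simp [g, hm0, h0 i p hp]
    · have e1 : Real.toNNReal (-2) = 0 := Real.toNNReal_of_nonpos (by norm_num)
      simp [g, pathHeight, hle'.1, e1]
    · simp [g, hm1, h1 i p hp]
    · have e1 : Real.toNNReal (1 - 3) = 0 := Real.toNNReal_of_nonpos (by norm_num)
      have e2 : Real.toNNReal (3 - 2) = 1 := by norm_num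
      simp [g, pathHeight, hle'.2, e1, e2]
  · intro K hK
    obtain ⟨M, hM⟩ := (hK.image (f := fun p : Whisker x₀ => p.1.2) (by fun_prop)).bddAbove
    obtain ⟨M', hMM', hM'⟩ := hproper M
    refine ⟨{p | p.1.2 ≤ M'}, ?_, fun p hp => (hM ⟨p, hp, rfl⟩).trans hMM', ?_⟩
    · have hc : IsCompact ((Set.univ : Set X) ×ˢ Set.Icc (0 : ℝ≥0) M') :=
        isCompact_univ.prod isCompact_Icc
      have heq : {p : Whisker x₀ | p.1.2 ≤ M'} =
          Subtype.val ⁻¹' ((Set.univ : Set X) ×ˢ Set.Icc (0 : ℝ≥0) M') := by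
        ext p
        simp
      rw [heq]
      exact (isClosed_whisker x₀).isClosedEmbedding_subtypeVal.isCompact_preimage hc
    · intro i p hp1 hp2 t hK'
      have h3 := hM' i p p.2 (not_le.1 hp1) (not_le.1 hp2)
      have h4 : pathHeight p.1.1.1.2 p.1.2.1.2 (μ i p) t ≤ M := hM ⟨_, hK', rfl⟩
      exact absurd (h3.trans_le (le_max_left _ _)) (not_lt.2 h4)

/-- With several planners available, one of them is switched off near infinity, where all the
others simply move along the half-line. -/
theorem TCLE.pTCLE_whisker_succ {X : Type*} [TopologicalSpace X] [CompactSpace X] [T1Space X]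
    (x₀ : X) {n : ℕ} (h : TCLE X (n + 1)) : PTCLE (Whisker x₀) (n + 1) := by
  classical
  obtain ⟨U, F, hU, hcov, hF, hFe⟩ := h.exists_continuousOn
  obtain ⟨j, hj⟩ : ∃ j, (x₀, x₀) ∈ U j := by
    simpa using (hcov.symm ▸ mem_univ (x₀, x₀) : (x₀, x₀) ∈ ⋃ i, U i)
  let ρ : Whisker x₀ × Whisker x₀ → X × X := fun p => (p.1.1.1, p.2.1.1)
  have hρ : Continuous ρ := by fun_prop
  let m : Whisker x₀ × Whisker x₀ → ℝ≥0 := fun p => min p.1.1.2 p.2.1.2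
  have hm : Continuous m := by fun_prop
  have hρm : ∀ p, 0 < m p → p.1.1.1 = x₀ ∧ p.2.1.1 = x₀ := by
    intro p hp
    obtain ⟨ha, hb⟩ := lt_min_iff.1 hp
    exact ⟨p.1.2.resolve_right ha.ne', p.2.2.resolve_right hb.ne'⟩
  have hfar : IsOpen {p | 1 < m p} := isOpen_lt continuous_const hm
  have hnear : ∀ c, IsOpen {p | m p < c} := fun c => isOpen_lt hm continuous_const
  have hρF : ∀ i, ContinuousOn (Function.uncurry fun p => F i (ρ p)) ((ρ ⁻¹' U i) ×ˢ Set.univ) :=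
    fun i => (hF i).comp
      (f := fun q : (Whisker x₀ × Whisker x₀) × unitInterval => (ρ q.1, q.2))
      (by fun_prop) fun q hq => ⟨hq.1, hq.2⟩
  refine PTCLE.whisker
    (fun i => if i = j then ρ ⁻¹' U i ∩ {p | m p < 2}
      else (ρ ⁻¹' U i ∩ {p | m p < 1}) ∪ {p | 1 < m p}) ?_ ?_
    (fun i p t => if i ≠ j ∧ 1 < m p then p.1.1.1 else F i (ρ p) t) ?_
    (fun i p => if i ≠ j ∧ 1 < m p then m p else 0) ?_ ?_ ?_ ?_ ?_ ?_
  · intro i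
    split_ifs
    · exact ((hU i).preimage hρ).inter (hnear 2)
    · exact (((hU i).preimage hρ).inter (hnear 1)).union hfar
  · refine Set.eq_univ_of_forall fun p => Set.mem_iUnion.2 ?_
    by_cases hp : 1 < m p
    · obtain ⟨k, hk⟩ := exists_ne j
      exact ⟨k, by simp [hk, hp]⟩
    obtain ⟨i, hi⟩ : ∃ i, ρ p ∈ U i := by
      simpa using (hcov.symm ▸ mem_univ (ρ p) : ρ p ∈ ⋃ i, U i)
    rcases eq_or_lt_of_le (zero_le (a := m p)) with h0 | h0
    · refine ⟨i, ?_⟩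
      split_ifs
      · exact ⟨hi, by simp [← h0]⟩
      · exact Or.inl ⟨hi, by simp [← h0]⟩
    · refine ⟨j, ?_⟩
      have : ρ p = (x₀, x₀) := Prod.ext (hρm p h0).1 (hρm p h0).2
      simp only [if_true]
      exact ⟨by simpa [this] using hj, (not_lt.1 hp).trans_lt (by norm_num)⟩
  · intro i
    by_cases hij : i = j
    · simp only [hij, ne_eq, not_true_eq_false, false_and, if_false, if_true]
      exact (hρF j).mono (Set.prod_mono inter_subset_left subset_rfl)
    · simp only [hij, ne_eq, not_false_eq_true, true_and, if_false, Set.union_prod]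
      refine ContinuousOn.union_of_isOpen ?_ ?_
        ((((hU i).preimage hρ).inter (hnear 1)).prod isOpen_univ) (hfar.prod isOpen_univ)
      · refine ((hρF i).mono (Set.prod_mono inter_subset_left subset_rfl)).congr ?_
        rintro ⟨p, t⟩ ⟨⟨-, hp⟩, -⟩
        exact if_neg (not_lt.2 (le_of_lt hp))
      · refine ContinuousOn.congr (f := fun q => q.1.1.1.1) (by fun_prop) ?_
        rintro ⟨p, t⟩ ⟨hp, -⟩
        exact if_pos hp
  · intro i
    by_cases hij : i = j
    · simp only [hij, ne_eq, not_true_eq_false, false_and, if_false]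
      exact continuousOn_const
    · simp only [hij, ne_eq, not_false_eq_true, true_and, if_false]
      refine ContinuousOn.union_of_isOpen ?_ ?_ (((hU i).preimage hρ).inter (hnear 1)) hfar
      · refine ContinuousOn.congr (f := fun _ => 0) continuousOn_const ?_
        rintro p ⟨-, hp⟩
        exact if_neg (not_lt.2 (le_of_lt hp))
      · exact hm.continuousOn.congr fun p hp => if_pos hp
  · intro i p hp
    beta_reduce at hp ⊢
    split_ifs with h2
    · rfl
    · refine (hFe i (ρ p) ?_).1
      split_ifs at hp with h3
      · exact hp.1
      · exact (hp.resolve_right fun h4 => h2 ⟨h3, h4⟩).1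
  · intro i p hp
    beta_reduce at hp ⊢
    split_ifs with h2
    · have := hρm p (zero_lt_one.trans h2.2)
      rw [this.1, this.2]
    · refine (hFe i (ρ p) ?_).2
      split_ifs at hp with h3
      · exact hp.1
      · exact (hp.resolve_right fun h4 => h2 ⟨h3, h4⟩).1
  · intro i p
    split_ifs
    · exact le_rfl
    · exact zero_le
  · intro i p _ h2 t
    have h3 : i ≠ j ∧ 1 < m p := by
      by_contra h3
      exact h2 (if_neg h3)
    simp only [if_pos h3]
    exact (hρm p (zero_lt_one.trans h3.2)).1
  · intro M
    refine ⟨max M 2, le_max_left _ _, fun i p hp h1 h2 => ?_⟩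
    have h3 : max M 2 < m p := lt_min h1 h2
    obtain ⟨hM, h2m⟩ := max_lt_iff.1 h3
    have hij : i ≠ j := by
      rintro rfl
      simp only [if_true] at hp
      exact lt_asymm hp.2 h2m
    have h1m : 1 < m p := lt_trans (by norm_num) h2m
    simpa [hij, h1m] using hM

/-- With a single planner, moving back towards the base point and then forth to the target can be
contracted, as the end points leave `X`, to the stationary motion at the base point. -/
theorem TCLE.pTCLE_whisker_zero {X : Type*} [TopologicalSpace X] [CompactSpace X] [T1Space X]
    (x₀ : X) (h : TCLE X 0) : PTCLE (Whisker x₀) 0 := by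
  obtain ⟨U, F, hU, hcov, hF, hFe⟩ := h.exists_continuousOn
  have hU0 : U 0 = Set.univ := by
    rw [← hcov]
    exact (ciSup_unique (ι := Fin 1) (s := U)).symm
  have hc : Continuous (Function.uncurry (F 0)) := by
    have := hF 0
    rwa [hU0, Set.univ_prod_univ, continuousOn_univ] at this
  have hγ0 : ∀ x, F 0 (x₀, x) 0 = x₀ := fun x => (hFe 0 (x₀, x) (by simp [hU0])).1
  have hγ1 : ∀ x, F 0 (x₀, x) 1 = x := fun x => (hFe 0 (x₀, x) (by simp [hU0])).2
  let γ : X → ℝ → X := fun x r => F 0 (x₀, x) (Set.projIcc 0 1 zero_le_one r)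
  have hγ : Continuous (Function.uncurry γ) :=
    hc.comp (f := fun q : X × ℝ => ((x₀, q.1), Set.projIcc (0 : ℝ) 1 zero_le_one q.2))
      (by have := continuous_projIcc (h := zero_le_one (α := ℝ)); fun_prop)
  have hγle : ∀ x r, r ≤ 0 → γ x r = x₀ := fun x r hr => by
    simp only [γ, Set.projIcc_of_le_left _ hr]
    exact hγ0 x
  have hγge : ∀ x r, 1 ≤ r → γ x r = x := fun x r hr => by
    simp only [γ, Set.projIcc_of_right_le _ hr]
    exact hγ1 x
  clear_value γ
  let m : Whisker x₀ × Whisker x₀ → ℝ≥0 := fun p => min p.1.1.2 p.2.1.2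
  have hm : Continuous m := by fun_prop
  have hρm : ∀ p, 0 < m p → p.1.1.1 = x₀ ∧ p.2.1.1 = x₀ := by
    intro p hp
    obtain ⟨ha, hb⟩ := lt_min_iff.1 hp
    exact ⟨p.1.2.resolve_right ha.ne', p.2.2.resolve_right hb.ne'⟩
  refine PTCLE.whisker (fun _ => Set.univ) (fun _ => isOpen_univ) (Set.iUnion_const _)
    (fun _ p t => if (t : ℝ) ≤ 1 / 2 then γ p.1.1.1 (max (m p) (1 - 2 * t))
      else γ p.2.1.1 (max (m p) (2 * t - 1))) ?_
    (fun _ p => m p - 1) ?_ ?_ ?_ ?_ ?_ ?_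
  · refine fun _ => Continuous.continuousOn (Continuous.if_le ?_ ?_ (by fun_prop) (by fun_prop) ?_)
    · exact hγ.comp (f := fun q : (Whisker x₀ × Whisker x₀) × unitInterval =>
        (q.1.1.1.1, max (m q.1 : ℝ) (1 - 2 * q.2))) (by fun_prop)
    · exact hγ.comp (f := fun q : (Whisker x₀ × Whisker x₀) × unitInterval =>
        (q.1.2.1.1, max (m q.1 : ℝ) (2 * q.2 - 1))) (by fun_prop)
    · rintro ⟨p, t⟩ ht
      simp only at ht
      simp only [ht]
      rcases eq_or_lt_of_le (zero_le (a := m p)) with h0 | h0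
      · rw [hγle _ _ (by simp [← h0]), hγle _ _ (by simp [← h0])]
      · rw [(hρm p h0).1, (hρm p h0).2]
        norm_num
  · exact fun _ => by fun_prop
  · intro _ p _
    simpa using hγge _ _ (le_max_right _ _)
  · intro _ p _
    have : ¬ ((1 : unitInterval) : ℝ) ≤ 1 / 2 := by norm_num
    simp only [this, if_false]
    exact hγge _ _ (le_max_of_le_right (by norm_num))
  · exact fun _ p => tsub_le_self
  · intro _ p _ hp t
    have h1 : 1 < m p := by
      by_contra h1
      exact hp (tsub_eq_zero_of_le (not_lt.1 h1))
    have h1' : (1 : ℝ) ≤ m p := by exact_mod_cast h1.le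
    have h2 := hρm p (zero_lt_one.trans h1)
    rw [hγge _ _ (le_max_of_le_left h1'), hγge _ _ (le_max_of_le_left h1'), h2.1, h2.2, ite_self]
  · intro M
    refine ⟨M + 1, le_self_add, fun _ p _ h1 h2 => ?_⟩
    exact lt_tsub_iff_right.2 (lt_min h1 h2)

/-- A retract inherits motion planners, proper or not, as non-proper ones. -/
theorem PTCLE.tCLE_of_retract {A B : Type*} [TopologicalSpace A] [TopologicalSpace B] {n : ℕ}
    (h : PTCLE B n) {ι : A → B} {ρ : B → A} (hι : Continuous ι) (hρ : Continuous ρ)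
    (hρι : ∀ a, ρ (ι a) = a) : TCLE A n := by
  obtain ⟨U, hU, hcov, s, hsc, hse, -⟩ := h
  refine ⟨fun i => Prod.map ι ι ⁻¹' U i, fun i => (hU i).preimage (by fun_prop), ?_, fun i =>
    ⟨fun p => (⟨ρ, hρ⟩ : C(B, A)).comp (s i ⟨Prod.map ι ι p, p.2⟩), ?_, ?_⟩⟩
  · rw [← Set.preimage_iUnion, hcov, Set.preimage_univ]
  · exact (ContinuousMap.continuous_postcomp _).comp
      ((hsc i).comp (Continuous.subtype_mk (by fun_prop) _))
  · intro p
    have := hse i ⟨Prod.map ι ι p, p.2⟩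
    simp [this.1, this.2, hρι]

theorem pTCLE_wedge_halfLine_iff {X : Type*} [TopologicalSpace X] [CompactSpace X] [T1Space X]
    (x₀ : X) (n : ℕ) : PTCLE (Wedge X ℝ≥0 x₀ 0) n ↔ TCLE X n := by
  obtain ⟨e⟩ := nonempty_homeomorph_wedge x₀
  constructor
  · intro h
    exact (h.of_homeomorph e.symm).tCLE_of_retract
      (ι := fun x => (⟨(x, 0), Or.inr rfl⟩ : Whisker x₀)) (ρ := fun p => p.1.1)
      (by fun_prop) (by fun_prop) fun _ => rfl
  · intro h
    cases n with
    | zero => exact (h.pTCLE_whisker_zero x₀).of_homeomorph e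
    | succ n => exact (h.pTCLE_whisker_succ x₀).of_homeomorph e

/-- For any non-empty compact ANR space `X` with base point `x₀`,
`pTC (X ∨ [0, ∞)) = TC X`, the wedge being taken at `x₀ ∈ X` and `0 ∈ [0, ∞)`. -/
theorem pTC_wedge_halfLine {X : Type u} [TopologicalSpace X] [CompactSpace X]
    (hX : IsANR X) (x₀ : X) :
    pTC (Wedge X ℝ≥0 x₀ 0) = TC' X := by
  have := hX.1
  simp only [pTC, TC', pTCLE_wedge_halfLine_iff]

end
end

section
/- For any non-empty compact ANR space X, pTC(X × ℝ) = ∞. -/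
open Set unitInterval
open scoped NNReal ENNReal

noncomputable section

universe u v

/-- The product of a non-empty compact space with `ℝ` has no finite proper topological complexity:
a path joining two points far out in opposite ends has to cross `X × {0}`. -/
theorem not_PTCLE_prod_real {X : Type*} [TopologicalSpace X] [Nonempty X] [CompactSpace X]
    (n : ℕ) : ¬ PTCLE (X × ℝ) n := by
  rintro ⟨U, -, hU, s, -, hs, hK⟩
  obtain ⟨L, hL, -, hL'⟩ := hK (univ ×ˢ {0}) (isCompact_univ.prod isCompact_singleton)
  obtain ⟨R, hR⟩ := (hL.image continuous_snd).isBounded.exists_norm_le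
  have hfar (x : X) (t : ℝ) (ht : |R| + 1 ≤ |t|) : (x, t) ∉ L := fun h => by
    have h₁ : |t| ≤ R := hR t ⟨_, h, rfl⟩
    linarith [le_abs_self R]
  have hpos : 0 < |R| + 1 := by positivity
  obtain ⟨x₀⟩ := ‹Nonempty X›
  obtain ⟨i, hi⟩ := mem_iUnion.1
    (hU ▸ mem_univ ((x₀, -(|R| + 1)), (x₀, |R| + 1)) :
      ((x₀, -(|R| + 1)), (x₀, |R| + 1)) ∈ ⋃ i, U i)
  let p : U i := ⟨_, hi⟩
  have h₀ : (s i p 0).2 = -(|R| + 1) := by rw [(hs i p).1]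
  have h₁ : (s i p 1).2 = |R| + 1 := by rw [(hs i p).2]
  have hcont : Continuous fun t : unitInterval => (s i p t).2 :=
    continuous_snd.comp (s i p).continuous
  obtain ⟨t, ht⟩ := mem_range_of_exists_le_of_exists_ge hcont
    ⟨0, (h₀.trans_le (neg_nonpos.2 hpos.le) : (s i p 0).2 ≤ 0)⟩ ⟨1, h₁ ▸ hpos.le⟩
  exact hL' i p (hfar _ _ (by rw [abs_neg]; exact le_abs_self _))
    (hfar _ _ (le_abs_self _)) t ⟨mem_univ _, ht⟩

/-- For any non-empty compact ANR space `X`, `pTC (X × ℝ) = ∞`. -/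
theorem pTC_prod_real {X : Type u} [TopologicalSpace X] [Nonempty X] [CompactSpace X]
    (hX : IsANR X) :
    pTC (X × ℝ) = ⊤ := by
  refine sInf_eq_top.2 ?_
  rintro _ ⟨m, -, hm⟩
  exact absurd hm (not_PTCLE_prod_real m)

end
end

section
/- For any non-empty compact ANR space X with a chosen base point x₀, pTC(X ∨ ℝ) = ∞, where X ∨ ℝ denotes the wedge obtained as the quotient of the disjoint union of X and ℝ identifying x₀ ∈ X with 0 ∈ ℝ. -/
open Set unitInterval
open scoped NNReal ENNReal

noncomputable section

universe u v

/-- The projection of `X ∨ ℝ` onto `ℝ` collapsing `X` to `0`. -/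
def Wedge.toReal {X : Type u} [TopologicalSpace X] (x₀ : X) : Wedge X ℝ x₀ 0 → ℝ :=
  Quot.lift (Sum.elim (fun _ => 0) id) (by rintro _ _ ⟨rfl, rfl⟩; rfl)

theorem Wedge.continuous_toReal {X : Type u} [TopologicalSpace X] (x₀ : X) :
    Continuous (Wedge.toReal x₀) :=
  continuous_quot_lift _ (continuous_const.sumElim continuous_id)

theorem Wedge.mem_range_of_toReal_eq_zero {X : Type u} [TopologicalSpace X] (x₀ : X)
    (w : Wedge X ℝ x₀ 0) (hw : Wedge.toReal x₀ w = 0) :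
    w ∈ Set.range (fun x : X => (Quot.mk _ (Sum.inl x) : Wedge X ℝ x₀ 0)) := by
  induction w using Quot.ind with
  | mk a =>
    rcases a with x | r
    · exact ⟨x, rfl⟩
    · obtain rfl : r = 0 := hw
      exact ⟨x₀, Quot.sound ⟨rfl, rfl⟩⟩

/-- Motion planners on `X ∨ ℝ` cannot be proper: a path joining the two ends meets `X`. -/
theorem not_PTCLE_wedge_real {X : Type u} [TopologicalSpace X] [CompactSpace X] (x₀ : X) (n : ℕ) :
    ¬ PTCLE (Wedge X ℝ x₀ 0) n := by
  rintro ⟨U, -, hcov, s, -, hs, hproper⟩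
  obtain ⟨L, hL, -, hLK⟩ := hproper
    (Set.range (fun x : X => (Quot.mk _ (Sum.inl x) : Wedge X ℝ x₀ 0)))
    (isCompact_range (continuous_quot_mk.comp continuous_inl))
  obtain ⟨R, hR⟩ := (hL.image (Wedge.continuous_toReal x₀)).isBounded.exists_norm_le
  set M : ℝ := |R| + 1
  have hRM : R < M := by have := le_abs_self R; simp only [M]; linarith
  have hM : 0 < M := by positivity
  have hnot (r : ℝ) (hr : |r| = M) : (Quot.mk _ (Sum.inr r) : Wedge X ℝ x₀ 0) ∉ L := by
    intro h
    have h' : |r| ≤ R := hR _ ⟨_, h, rfl⟩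
    linarith
  have hmem : ((Quot.mk _ (Sum.inr (-M)), Quot.mk _ (Sum.inr M)) :
      Wedge X ℝ x₀ 0 × Wedge X ℝ x₀ 0) ∈ ⋃ i, U i := hcov ▸ Set.mem_univ _
  obtain ⟨i, hi⟩ := Set.mem_iUnion.1 hmem
  obtain ⟨h0, h1⟩ := hs i ⟨_, hi⟩
  have hcont : Continuous fun t => Wedge.toReal x₀ (s i ⟨_, hi⟩ t) :=
    (Wedge.continuous_toReal x₀).comp (s i ⟨_, hi⟩).continuous
  obtain ⟨t, ht⟩ := mem_range_of_exists_le_of_exists_ge (c := (0 : ℝ)) hcont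
    ⟨0, by rw [h0]; exact neg_nonpos.2 hM.le⟩ ⟨1, by rw [h1]; exact hM.le⟩
  exact hLK i ⟨_, hi⟩ (hnot _ (by rw [abs_neg, abs_of_pos hM])) (hnot _ (abs_of_pos hM)) t
    (Wedge.mem_range_of_toReal_eq_zero x₀ _ ht)

/-- For any non-empty compact ANR space `X` with base point `x₀`, `pTC (X ∨ ℝ) = ∞`, the
wedge being taken at `x₀ ∈ X` and `0 ∈ ℝ`. -/
theorem pTC_wedge_real {X : Type u} [TopologicalSpace X] [CompactSpace X]
    (hX : IsANR X) (x₀ : X) :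
    pTC (Wedge X ℝ x₀ 0) = ⊤ := by
  refine sInf_eq_top.2 ?_
  rintro _ ⟨m, -, hm⟩
  exact absurd hm (not_PTCLE_wedge_real x₀ m)

end
end

section
/- For any non-empty compact ANR space X and any integer n ≥ 1, pTC(X × ℝⁿ) ≥ TC(X × S^{n-1}), where S^{n-1} is the unit sphere in ℝⁿ. -/
open Set unitInterval
open scoped NNReal ENNReal

noncomputable section

universe u v

/-- Suppose that `r` is a continuous map to `Y` from the complement of a compact subset `K` of `Z`,
which admits continuous right inverses avoiding any given compact subset of `Z`. Then the
topological complexity of `Y` is bounded by the proper topological complexity of `Z`. -/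
theorem PTCLE.tcle_of_exists_section {Y Z : Type*} [TopologicalSpace Y] [TopologicalSpace Z]
    {m : ℕ} (h : PTCLE Z m) {K : Set Z} (hK : IsCompact K) {r : ↥Kᶜ → Y} (hr : Continuous r)
    (hj : ∀ L : Set Z, IsCompact L → ∃ j : Y → Z, Continuous j ∧ (∀ y, j y ∉ L) ∧
      ∀ y (hy : j y ∈ Kᶜ), r ⟨j y, hy⟩ = y) :
    TCLE Y m := by
  obtain ⟨U, hUo, hUc, s, hs, hends, hprop⟩ := h
  obtain ⟨L, hL, -, hLs⟩ := hprop K hK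
  obtain ⟨j, hjc, hjL, hrj⟩ := hj L hL
  refine ⟨fun i => Prod.map j j ⁻¹' U i, fun i => (hUo i).preimage (hjc.prodMap hjc), ?_, ?_⟩
  · rw [← preimage_iUnion, hUc, preimage_univ]
  intro i
  let φ : (Prod.map j j ⁻¹' U i : Set (Y × Y)) → U i := fun p => ⟨Prod.map j j p, p.2⟩
  have hφ : Continuous φ := ((hjc.prodMap hjc).comp continuous_subtype_val).subtype_mk _
  have havoid (p) (t : unitInterval) : s i (φ p) t ∈ Kᶜ :=
    hLs i (φ p) (hjL _) (hjL _) t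
  let F : C((Prod.map j j ⁻¹' U i : Set (Y × Y)) × unitInterval, Y) :=
    ⟨fun q => r ⟨s i (φ q.1) q.2, havoid q.1 q.2⟩, hr.comp (Continuous.subtype_mk
      (((hs i).comp (hφ.comp continuous_fst)).eval continuous_snd) _)⟩
  refine ⟨F.curry, F.curry.continuous, fun p => ?_⟩
  have key (t : unitInterval) (y : Y) (h : s i (φ p) t = j y) : F.curry p t = y := by
    have hy : j y ∈ Kᶜ := h ▸ havoid p t
    calc F.curry p t = r ⟨j y, hy⟩ := congrArg r (Subtype.ext h)
      _ = y := hrj y hy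
  exact ⟨key 0 _ (hends i (φ p)).1, key 1 _ (hends i (φ p)).2⟩

/-- If `X` is compact, then `TC (X × S) ≤ pTC (X × E)`, where `S` is the unit sphere of a normed
space `E`. -/
theorem PTCLE.tcle_prod_sphere {X E : Type*} [TopologicalSpace X] [CompactSpace X]
    [NormedAddCommGroup E] [NormedSpace ℝ E] {m : ℕ} (h : PTCLE (X × E) m) :
    TCLE (X × Metric.sphere (0 : E) 1) m := by
  have hne (z : ↥((univ : Set X) ×ˢ ({0} : Set E))ᶜ) : (z : X × E).2 ≠ 0 := fun hz =>
    z.2 ⟨mem_univ _, hz⟩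
  refine h.tcle_of_exists_section (K := univ ×ˢ {0})
    (isCompact_univ.prod isCompact_singleton)
    (r := fun z => (z.1.1, ⟨‖z.1.2‖⁻¹ • z.1.2, by simp [norm_smul, hne z]⟩)) ?_ ?_
  · refine (by fun_prop : Continuous fun z : ↥((univ : Set X) ×ˢ ({0} : Set E))ᶜ =>
      (z : X × E).1).prodMk (Continuous.subtype_mk ?_ _)
    have hsnd : Continuous fun z : ↥((univ : Set X) ×ˢ ({0} : Set E))ᶜ => (z : X × E).2 := by
      fun_prop
    exact (hsnd.norm.inv₀ fun z => norm_ne_zero_iff.2 (hne z)).smul hsnd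
  · intro L hL
    obtain ⟨R, hR, hLR⟩ := (hL.image continuous_snd).isBounded.exists_pos_norm_lt
    refine ⟨fun y => (y.1, R • (y.2 : E)), by fun_prop, fun y hy => ?_, fun y _ => ?_⟩
    · have := hLR _ (mem_image_of_mem _ hy)
      simp [norm_smul, abs_of_pos hR] at this
    · ext
      · rfl
      · simp [hR.ne', norm_smul, abs_of_pos hR, smul_smul]

/-- For any non-empty compact ANR space `X` and `n ≥ 1`,
`pTC (X × ℝⁿ) ≥ TC (X × S^{n-1})`, where `S^{n-1}` is the unit sphere in `ℝⁿ`. -/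
theorem TC_le_pTC_prod_euclidean {X : Type u} [TopologicalSpace X] [Nonempty X]
    [CompactSpace X] (hX : IsANR X) (n : ℕ) (hn : 1 ≤ n) :
    TC' (X × Metric.sphere (0 : EuclideanSpace ℝ (Fin n)) 1) ≤
      pTC (X × EuclideanSpace ℝ (Fin n)) := by
  refine le_sInf ?_
  rintro _ ⟨m, rfl, h⟩
  exact sInf_le ⟨m, rfl, h.tcle_prod_sphere⟩

end
end

section
/- pTC(ℝ) = ∞, where ℝ is the real line with its usual topology. -/
open Set unitInterval
open scoped NNReal ENNReal

noncomputable section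

universe u v

/-- `pTC (ℝ) = ∞`. -/
theorem pTC_real : pTC ℝ = ⊤ := by
  refine sInf_eq_top.mpr ?_
  rintro _ ⟨m, rfl, U, -, hcover, s, -, hends, hproper⟩
  exfalso
  obtain ⟨L, hL, -, hs⟩ := hproper {0} isCompact_singleton
  obtain ⟨R, hR⟩ := hL.isBounded.subset_closedBall 0
  have hfar : ∀ x : ℝ, R < |x| → x ∉ L := fun x hx hxL => by
    have hxR := hR hxL
    rw [mem_closedBall_zero_iff, Real.norm_eq_abs] at hxR
    exact hx.not_ge hxR
  have hlt : R < |R| + 1 := (le_abs_self R).trans_lt (lt_add_one _)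
  have hpos : 0 ≤ |R| + 1 := by positivity
  obtain ⟨i, hi⟩ := mem_iUnion.mp
    (hcover.symm ▸ mem_univ _ : (-(|R| + 1), |R| + 1) ∈ ⋃ i, U i)
  obtain ⟨h0, h1⟩ := hends i ⟨_, hi⟩
  obtain ⟨t, ht⟩ : (0 : ℝ) ∈ range (s i ⟨_, hi⟩) :=
    mem_range_of_exists_le_of_exists_ge (s i ⟨_, hi⟩).continuous
      ⟨0, h0.trans_le (neg_nonpos.mpr hpos)⟩ ⟨1, hpos.trans_eq h1.symm⟩
  exact hs i ⟨_, hi⟩ (hfar _ (by rwa [abs_neg, abs_of_nonneg hpos]))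
    (hfar _ (by rwa [abs_of_nonneg hpos])) t ht

end
end
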